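/- arXiv:1103.1670 — 4 statements merged into one kernel-verified Lean document; each statement's English description precedes it below -/
import Mathlib

section
/- Let d ≥ 2. There exist constants C > 0, c > 0 and C' > 0 such that for every integer R ≥ 1, the number of pairs (n,m) ∈ ℤ^d × ℤ^d satisfying |n_j| ≤ C·R^{1/2} and |m_j| ≤ C·R^{1/2} for 1 ≤ j ≤ d−1, |n_d| ≤ C·R and |m_d| ≤ C·R, and (n_d − m_d) − Σ_{j=1}^{d−1} (n_j − m_j)² = R, is at least c·R^{d} and at most C'·R^{d}. (Equivalently, writing R = q^{2d/(d+1)}, this count is comparable to q^{d} · q^{d−2+2/(d+1)}, showing the exponent d − 2 + 2/(d+1) in the non-isotropic lattice point counting theorem cannot be improved, even for infinitely smooth φ.) -/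
noncomputable section

/-- The set of pairs of lattice points in the sharpness example:
`|n_j|, |m_j| ≤ C R^{1/2}` for `1 ≤ j ≤ d−1`, `|n_d|, |m_d| ≤ C R`, and
`(n_d − m_d) − Σ_{j=1}^{d−1} (n_j − m_j)² = R`. -/
def sharpnessSet (d : ℕ) (hd : 0 < d) (C : ℝ) (R : ℕ) :
    Set ((Fin d → ℤ) × (Fin d → ℤ)) :=
  {nm | (∀ i : Fin d,
          (i.val < d - 1 → |(nm.1 i : ℝ)| ≤ C * (R : ℝ) ^ ((1 : ℝ) / 2) ∧
            |(nm.2 i : ℝ)| ≤ C * (R : ℝ) ^ ((1 : ℝ) / 2)) ∧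
          (i.val = d - 1 → |(nm.1 i : ℝ)| ≤ C * (R : ℝ) ∧ |(nm.2 i : ℝ)| ≤ C * (R : ℝ))) ∧
        (nm.1 ⟨d - 1, Nat.sub_lt hd one_pos⟩ - nm.2 ⟨d - 1, Nat.sub_lt hd one_pos⟩) -
          ∑ i ∈ Finset.univ.filter (fun i : Fin d => i.val < d - 1),
            (nm.1 i - nm.2 i) ^ 2 = (R : ℤ)}

/-- Parametrisation of the level set by the free coordinates. -/
def sharpParam (k R : ℕ) (p : (Fin k → ℤ) × (Fin k → ℤ) × ℤ) :
    (Fin (k + 1) → ℤ) × (Fin (k + 1) → ℤ) :=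
  (Fin.snoc (α := fun _ => ℤ) p.1 (p.2.2 + R + ∑ j, (p.1 j - p.2.1 j) ^ 2),
    Fin.snoc (α := fun _ => ℤ) p.2.1 p.2.2)

lemma sharpParam_injective (k R : ℕ) : Function.Injective (sharpParam k R) := by
  rintro ⟨a, b, t⟩ ⟨a', b', t'⟩ h
  simp only [sharpParam, Prod.mk.injEq, Fin.snoc_inj] at h
  obtain ⟨⟨h1, -⟩, h2, h3⟩ := h
  subst h1 h2 h3
  rfl

lemma mem_sharp (k : ℕ) (h : 0 < k + 1) (C : ℝ) (R : ℕ)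
    (nm : (Fin (k + 1) → ℤ) × (Fin (k + 1) → ℤ)) :
    nm ∈ sharpnessSet (k + 1) h C R ↔
      ((∀ j : Fin k, |(nm.1 j.castSucc : ℝ)| ≤ C * √(R : ℝ) ∧
          |(nm.2 j.castSucc : ℝ)| ≤ C * √(R : ℝ)) ∧
        (|(nm.1 (Fin.last k) : ℝ)| ≤ C * R ∧ |(nm.2 (Fin.last k) : ℝ)| ≤ C * R)) ∧
      nm.1 (Fin.last k) - nm.2 (Fin.last k)
        - ∑ j : Fin k, (nm.1 j.castSucc - nm.2 j.castSucc) ^ 2 = (R : ℤ) := by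
  have e : (⟨k + 1 - 1, Nat.sub_lt h one_pos⟩ : Fin (k + 1)) = Fin.last k := rfl
  simp only [sharpnessSet, Set.mem_ofPred_eq, e, Finset.sum_filter, Fin.sum_univ_castSucc,
    Fin.forall_fin_succ', ← Real.sqrt_eq_rpow]
  have ne : ∀ i : Fin k, (i : ℕ) ≠ k := fun i => i.isLt.ne
  simp [ne]

lemma sharp_lower (k R : ℕ) (h : 0 < k + 1) (hf : (sharpnessSet (k + 1) h (k + 2) R).Finite) :
    (R : ℝ) ^ (k + 1) ≤ (Set.ncard (sharpnessSet (k + 1) h (k + 2) R) : ℝ) := by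
  classical
  set s := Nat.sqrt R with hs
  set A : Finset (Fin k → ℤ) := Fintype.piFinset fun _ => Finset.Icc (0 : ℤ) s with hA
  set B : Finset ((Fin k → ℤ) × (Fin k → ℤ) × ℤ) := A ×ˢ A ×ˢ Finset.Icc (0 : ℤ) R with hB
  have hcard : B.card = (s + 1) ^ k * ((s + 1) ^ k * (R + 1)) := by
    simp [hB, hA, Finset.card_product]
  have hsub : sharpParam k R '' (B : Set _) ⊆ sharpnessSet (k + 1) h (k + 2) R := by
    rintro _ ⟨⟨a, b, t⟩, hm, rfl⟩
    simp only [hB, hA, Finset.coe_product, Set.mem_prod, Finset.mem_coe, Fintype.mem_piFinset,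
      Finset.mem_Icc] at hm
    obtain ⟨ha, hb, ht0, ht1⟩ := hm
    rw [mem_sharp]
    have hss : ((s : ℤ)) * s ≤ R := by exact_mod_cast Nat.sqrt_le R
    have hsr : (s : ℝ) ≤ √(R : ℝ) := Real.nat_sqrt_le_real_sqrt
    have hsum0 : 0 ≤ ∑ j, (a j - b j) ^ 2 := Finset.sum_nonneg fun _ _ => sq_nonneg _
    have hsum1 : ∑ j, (a j - b j) ^ 2 ≤ k * (R : ℤ) := by
      calc ∑ j, (a j - b j) ^ 2 ≤ ∑ j : Fin k, (R : ℤ) := by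
            refine Finset.sum_le_sum fun j _ => ?_
            have := ha j
            have := hb j
            refine le_trans ?_ hss
            nlinarith
        _ = _ := by simp
    have key : ∀ x : ℤ, 0 ≤ x ∧ x ≤ s → |(x : ℝ)| ≤ ((k : ℝ) + 2) * √(R : ℝ) := by
      rintro x ⟨h0, h1⟩
      have h0' : (0 : ℝ) ≤ x := by exact_mod_cast h0
      have h1' : (x : ℝ) ≤ s := by exact_mod_cast h1
      rw [abs_of_nonneg h0']
      have := Real.sqrt_nonneg (R : ℝ)
      nlinarith [(Nat.cast_nonneg k : (0 : ℝ) ≤ k)]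
    have key2 : ∀ x : ℤ, 0 ≤ x → x ≤ (k + 2) * R → |(x : ℝ)| ≤ ((k : ℝ) + 2) * R := by
      intro x h0 h1
      have h0' : (0 : ℝ) ≤ x := by exact_mod_cast h0
      rw [abs_of_nonneg h0']
      exact_mod_cast h1
    simp only [sharpParam, Fin.snoc_castSucc, Fin.snoc_last]
    refine ⟨⟨fun j => ⟨key _ (ha j), key _ (hb j)⟩, key2 _ (by positivity) (by linarith),
      key2 _ ht0 ?_⟩, by ring⟩
    nlinarith [(Nat.cast_nonneg k : (0 : ℤ) ≤ k)]
  have h1 : B.card ≤ Set.ncard (sharpnessSet (k + 1) h (k + 2) R) := by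
    have := Set.ncard_le_ncard hsub hf
    rwa [Set.ncard_image_of_injective _ (sharpParam_injective k R), Set.ncard_coe_finset] at this
  have h2 : R ^ (k + 1) ≤ B.card := by
    rw [hcard, ← mul_assoc, ← mul_pow, pow_succ]
    exact Nat.mul_le_mul (Nat.pow_le_pow_left (Nat.lt_succ_sqrt R).le _) (Nat.le_succ R)
  exact_mod_cast h2.trans h1

lemma sharp_upper (k R : ℕ) (hR : 1 ≤ R) (h : 0 < k + 1) :
    (sharpnessSet (k + 1) h (k + 2) R).Finite ∧
    (Set.ncard (sharpnessSet (k + 1) h (k + 2) R) : ℝ) ≤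
      (3 * ((k : ℝ) + 2)) ^ (2 * k + 1) * (R : ℝ) ^ (k + 1) := by
  classical
  set N := ⌊((k : ℝ) + 2) * √(R : ℝ)⌋₊ with hN
  set M := (k + 2) * R with hM
  set A : Finset (Fin k → ℤ) := Fintype.piFinset fun _ => Finset.Icc (-(N : ℤ)) N with hA
  set B : Finset ((Fin k → ℤ) × (Fin k → ℤ) × ℤ) :=
    A ×ˢ A ×ˢ Finset.Icc (-(M : ℤ)) M with hB
  have hi : ∀ n : ℕ, (Finset.Icc (-(n : ℤ)) n).card = 2 * n + 1 := by
    intro n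
    rw [Int.card_Icc]
    omega
  have hcard : B.card = (2 * N + 1) ^ k * ((2 * N + 1) ^ k * (2 * M + 1)) := by
    simp only [hB, hA, Finset.card_product, Fintype.card_piFinset_const, hi]
  have hsub : sharpnessSet (k + 1) h (k + 2) R ⊆ sharpParam k R '' (B : Set _) := by
    rintro ⟨n, m⟩ hnm
    rw [mem_sharp] at hnm
    obtain ⟨⟨h1, -, h3⟩, h4⟩ := hnm
    simp only at h1 h3 h4
    have key : ∀ x : ℤ, |(x : ℝ)| ≤ ((k : ℝ) + 2) * √(R : ℝ) → -(N : ℤ) ≤ x ∧ x ≤ N := by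
      intro x hx
      have : x.natAbs ≤ N := by
        apply Nat.le_floor
        rwa [Nat.cast_natAbs, Int.cast_abs]
      omega
    refine ⟨(fun j => n j.castSucc, fun j => m j.castSucc, m (Fin.last k)), ?_, ?_⟩
    · simp only [hB, hA, Finset.coe_product, Set.mem_prod, Finset.mem_coe, Fintype.mem_piFinset,
        Finset.mem_Icc]
      refine ⟨fun j => key _ (h1 j).1, fun j => key _ (h1 j).2, ?_⟩
      rw [← abs_le, hM]
      exact_mod_cast h3
    · simp only [sharpParam]
      have e : m (Fin.last k) + (R : ℤ) + ∑ j : Fin k, (n j.castSucc - m j.castSucc) ^ 2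
          = n (Fin.last k) := by linarith
      rw [e]
      exact Prod.ext (Fin.snoc_init_self n) (Fin.snoc_init_self m)
  have hfin : (sharpParam k R '' (B : Set _)).Finite := B.finite_toSet.image _
  refine ⟨hfin.subset hsub, ?_⟩
  have h1 : Set.ncard (sharpnessSet (k + 1) h (k + 2) R) ≤ B.card := by
    have := Set.ncard_le_ncard hsub hfin
    rwa [Set.ncard_image_of_injective _ (sharpParam_injective k R), Set.ncard_coe_finset] at this
  have hR' : (1 : ℝ) ≤ R := by exact_mod_cast hR
  have hs1 : 1 ≤ √(R : ℝ) := Real.one_le_sqrt.mpr hR'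
  have hk : (0 : ℝ) ≤ k := Nat.cast_nonneg k
  have hNle : (2 * (N : ℝ) + 1) ≤ 3 * ((k : ℝ) + 2) * √(R : ℝ) := by
    have : (N : ℝ) ≤ ((k : ℝ) + 2) * √(R : ℝ) := Nat.floor_le (by positivity)
    nlinarith
  have hMle : (2 * (M : ℝ) + 1) ≤ 3 * ((k : ℝ) + 2) * R := by
    rw [hM]; push_cast; nlinarith
  calc (Set.ncard (sharpnessSet (k + 1) h (k + 2) R) : ℝ) ≤ (B.card : ℝ) := by exact_mod_cast h1
    _ = (2 * (N : ℝ) + 1) ^ k * ((2 * (N : ℝ) + 1) ^ k * (2 * (M : ℝ) + 1)) := by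
        rw [hcard]; push_cast; ring
    _ ≤ (3 * ((k : ℝ) + 2) * √(R : ℝ)) ^ k * ((3 * ((k : ℝ) + 2) * √(R : ℝ)) ^ k *
          (3 * ((k : ℝ) + 2) * R)) := by gcongr
    _ = (3 * ((k : ℝ) + 2)) ^ (2 * k + 1) * ((√(R : ℝ) * √(R : ℝ)) ^ k * R) := by
        simp only [mul_pow]; ring
    _ = _ := by rw [Real.mul_self_sqrt (by positivity), pow_succ (R : ℝ) k]

/-- Sharpness of the non-isotropic counting theorem: for the paraboloid-type phase
`φ(x,y) = (x_d − y_d) − Σ_{j<d} (x_j − y_j)²`, the number of lattice point pairs in the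
corresponding non-isotropic box lying exactly on the level set `φ = R` is comparable
to `R^d`. -/
theorem sharpness_example (d : ℕ) (hd : 2 ≤ d) :
    ∃ C > (0 : ℝ), ∃ c > (0 : ℝ), ∃ C' > (0 : ℝ), ∀ R : ℕ, 1 ≤ R →
      c * (R : ℝ) ^ d ≤ (Set.ncard (sharpnessSet d (by omega) C R) : ℝ) ∧
      (Set.ncard (sharpnessSet d (by omega) C R) : ℝ) ≤ C' * (R : ℝ) ^ d := by
  obtain ⟨k, rfl⟩ : ∃ k, d = k + 1 := ⟨d - 1, by omega⟩
  refine ⟨(k : ℝ) + 2, by positivity, 1, one_pos, (3 * ((k : ℝ) + 2)) ^ (2 * k + 1),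
    by positivity, fun R hR => ?_⟩
  have hu := sharp_upper k R hR (by omega)
  refine ⟨?_, hu.2⟩
  rw [one_mul]
  exact sharp_lower k R (by omega) hu.1
end
end

section
/- Let d ≥ 2, let s satisfy (d+1)/2 ≤ s < d, and let α₁, …, α_d > 0 satisfy Σ_{j=1}^d α_j = d and α_j ≤ d/s for every j. Then there exists a constant C > 0 such that for every q ≥ 1, the Riesz s-energy of μ_q is bounded: ∬_{ℝ^d × ℝ^d} |x − y|^{−s} μ_q(x) μ_q(y) dx dy ≤ C. -/
noncomputable section

open MeasureTheory

/-- The Euclidean space `ℝ^d`. -/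
abbrev Euc (d : ℕ) := EuclideanSpace ℝ (Fin d)

/-- The measure density
`μ_q(x) = q^{−d} q^{d²/s} Σ_{a ∈ ℤ^d} Π_j ψ₀(a_j/q^{α_j}) ψ₀(q^{d/s}(x_j − a_j/q^{α_j}))`. -/
def muQ (d : ℕ) (s : ℝ) (α : Fin d → ℝ) (ψ₀ : ℝ → ℝ) (q : ℝ) (x : Euc d) : ℝ :=
  q ^ (-(d : ℝ)) * q ^ ((d : ℝ) ^ 2 / s) *
    ∑' a : Fin d → ℤ, ∏ j : Fin d,
      ψ₀ ((a j : ℝ) / q ^ (α j)) * ψ₀ (q ^ ((d : ℝ) / s) * (x j - (a j : ℝ) / q ^ (α j)))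

/-- ENNReal-valued `1/|u|`. -/
def ker (u : ℝ) : ENNReal := (ENNReal.ofReal |u|)⁻¹

/-- The one dimensional majorant of the density. -/
def nu (c h R x : ℝ) : ENNReal :=
  ENNReal.ofReal (h * R) * ∑ a ∈ Finset.Icc (-⌊c / h⌋) ⌊c / h⌋,
    (Set.Icc ((a : ℝ) * h - c / R) ((a : ℝ) * h + c / R)).indicator 1 x

lemma measurable_ker : Measurable ker := by
  unfold ker; fun_prop

lemma measurable_nu (c h R : ℝ) : Measurable (nu c h R) := by
  unfold nu
  refine Measurable.const_mul (Finset.measurable_fun_sum _ fun a _ => ?_) _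
  exact measurable_one.indicator measurableSet_Icc

lemma ker_rpow {u : ℝ} (hu : u ≠ 0) (t : ℝ) :
    (ker u) ^ t = ENNReal.ofReal (|u| ^ (-t)) := by
  have h : 0 < |u| := abs_pos.mpr hu
  rw [ker, ENNReal.inv_rpow, ENNReal.ofReal_rpow_of_pos h, ← ENNReal.ofReal_inv_of_pos (by positivity),
    Real.rpow_neg h.le]

lemma ker_neg (u : ℝ) : ker (-u) = ker u := by simp [ker]

lemma ker_anti {u v : ℝ} (h : |u| ≤ |v|) : ker v ≤ ker u := by
  unfold ker
  exact ENNReal.inv_le_inv.mpr (ENNReal.ofReal_le_ofReal h)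

lemma ae_ne_zero' : ∀ᵐ x : ℝ, x ≠ 0 := by
  have : volume ({0} : Set ℝ) = 0 := by simp
  exact measure_eq_zero_iff_ae_notMem.mp this

lemma lint_even (f : ℝ → ENNReal) (hf : ∀ x, f (-x) = f x) :
    ∫⁻ x, f x = 2 * ∫⁻ x in Set.Ioi 0, f x := by
  have h1 : ∫⁻ x in Set.Iic 0, f x = ∫⁻ x in Set.Ioi 0, f x := by
    rw [setLIntegral_congr Ioi_ae_eq_Ici]
    have := (Measure.measurePreserving_neg (volume : Measure ℝ)).setLIntegral_comp_preimage_emb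
      (MeasurableEquiv.neg ℝ).measurableEmbedding f (Set.Ici 0)
    rw [← this]
    simp [hf]
  rw [← lintegral_add_compl f (measurableSet_Ioi (a := (0:ℝ))), Set.compl_Ioi, h1, two_mul]

/-- Near part. -/
lemma lint_near {σ ρ : ℝ} (h1 : σ < 1) (hρ : 0 < ρ) :
    ∫⁻ x in Set.Icc (-ρ) ρ, (ker x) ^ σ ≤ ENNReal.ofReal (2 * (ρ ^ (1 - σ) / (1 - σ))) := by
  rw [← lintegral_indicator measurableSet_Icc, lint_even, ENNReal.ofReal_mul (by norm_num)]
  · rw [show ENNReal.ofReal 2 = 2 by simp]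
    gcongr
    rw [lintegral_indicator measurableSet_Icc, Measure.restrict_restrict measurableSet_Icc]
    have e : Set.Icc (-ρ) ρ ∩ Set.Ioi 0 = Set.Ioc 0 ρ := by
      ext x; simp only [Set.mem_inter_iff, Set.mem_Icc, Set.mem_Ioi, Set.mem_Ioc]
      constructor
      · rintro ⟨⟨_, b⟩, c⟩; exact ⟨c, b⟩
      · rintro ⟨b, c⟩; exact ⟨⟨by linarith, c⟩, b⟩
    rw [e]
    have h2 : ∫⁻ x in Set.Ioc 0 ρ, (ker x) ^ σ = ∫⁻ x in Set.Ioc 0 ρ, ENNReal.ofReal (x ^ (-σ)) := by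
      refine setLIntegral_congr_fun measurableSet_Ioc fun x hx => ?_
      rw [ker_rpow hx.1.ne', abs_of_pos hx.1]
    have hi := intervalIntegral.intervalIntegrable_rpow' (a := 0) (b := ρ) (r := -σ) (by linarith)
    rw [intervalIntegrable_iff_integrableOn_Ioc_of_le hρ.le] at hi
    rw [h2, ← ofReal_integral_eq_lintegral_ofReal hi]
    · rw [← intervalIntegral.integral_of_le hρ.le, integral_rpow (Or.inl (by linarith))]
      rw [Real.zero_rpow (by linarith), sub_zero, neg_add_eq_sub]
    · filter_upwards [self_mem_ae_restrict measurableSet_Ioc] with x hx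
      exact Real.rpow_nonneg hx.1.le _
  · intro x
    simp only [Set.indicator, Set.mem_Icc, ker_neg]
    congr 1
    rw [eq_iff_iff]; constructor <;> rintro ⟨a, b⟩ <;> constructor <;> linarith

lemma lint_max {ε : ℝ} (hε : 0 < ε) (w : ℝ) :
    ∫⁻ x, (ker (max |x| |w|)) ^ (1 + ε) ≤ ENNReal.ofReal (2 + 2 / ε) * (ker w) ^ ε := by
  by_cases hw : w = 0
  · subst hw
    have : ker 0 ^ ε = ⊤ := by simp [ker, hε]
    rw [this, ENNReal.mul_top]
    · exact le_top
    · have : 0 < 2 + 2 / ε := by positivity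
      simp [this]
  have hw' : 0 < |w| := abs_pos.mpr hw
  rw [lint_even _ (fun x => by simp), ker_rpow hw, ← ENNReal.ofReal_mul (by positivity)]
  have h1 : ∫⁻ x in Set.Ioi 0, ker (max |x| |w|) ^ (1 + ε) ≤
      (∫⁻ x in Set.Ioc 0 |w|, ker (max |x| |w|) ^ (1 + ε)) +
      ∫⁻ x in Set.Ioi |w|, ker (max |x| |w|) ^ (1 + ε) := by
    rw [← Set.Ioc_union_Ioi_eq_Ioi hw'.le]
    exact lintegral_union_le _ _ _
  have h2 : ∫⁻ x in Set.Ioc 0 |w|, ker (max |x| |w|) ^ (1 + ε) ≤ ENNReal.ofReal (|w| ^ (-ε)) := by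
    calc _ ≤ ∫⁻ x in Set.Ioc 0 |w|, ENNReal.ofReal (|w| ^ (-(1+ε))) := by
          refine lintegral_mono fun x => ?_
          rw [← ker_rpow hw]
          refine ENNReal.rpow_le_rpow (ker_anti ?_) (by linarith)
          rw [abs_of_nonneg (le_max_of_le_right hw'.le)]; exact le_max_right _ _
      _ = _ := by
          rw [setLIntegral_const, Real.volume_Ioc, sub_zero, ← ENNReal.ofReal_mul (by positivity)]
          congr 1
          nth_rewrite 2 [← Real.rpow_one |w|]
          rw [← Real.rpow_add hw']; ring_nf
  have h3 : ∫⁻ x in Set.Ioi |w|, ker (max |x| |w|) ^ (1 + ε) ≤ ENNReal.ofReal (|w| ^ (-ε) / ε) := by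
    have e : ∫⁻ x in Set.Ioi |w|, ker (max |x| |w|) ^ (1 + ε) =
        ∫⁻ x in Set.Ioi |w|, ENNReal.ofReal (x ^ (-(1+ε))) := by
      refine setLIntegral_congr_fun measurableSet_Ioi fun x hx => ?_
      have hx' : |w| < x := hx
      have hx0 : 0 < x := hw'.trans hx'
      rw [abs_of_pos hx0, max_eq_left hx'.le, ker_rpow hx0.ne', abs_of_pos hx0]
    rw [e, ← ofReal_integral_eq_lintegral_ofReal (integrableOn_Ioi_rpow_of_lt (by linarith) hw')]
    · rw [integral_Ioi_rpow_of_lt (by linarith) hw']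
      apply ENNReal.ofReal_le_ofReal
      rw [show -(1+ε) + 1 = -ε by ring, neg_div_neg_eq]
    · filter_upwards [self_mem_ae_restrict measurableSet_Ioi] with x hx
      exact Real.rpow_nonneg (hw'.trans hx).le _
  calc _ ≤ 2 * (ENNReal.ofReal (|w| ^ (-ε)) + ENNReal.ofReal (|w| ^ (-ε) / ε)) := by
        gcongr; exact h1.trans (add_le_add h2 h3)
    _ = ENNReal.ofReal (2 * (|w| ^ (-ε) + |w| ^ (-ε) / ε)) := by
        rw [ENNReal.ofReal_mul (by norm_num), ENNReal.ofReal_add (by positivity) (by positivity)]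
        simp
    _ ≤ _ := by
        apply ENNReal.ofReal_le_ofReal
        apply le_of_eq; field_simp

/-- The potential of one window. -/
lemma window {σ : ℝ} (h0 : 0 ≤ σ) (h1 : σ < 1) {c : ℝ} (hc : 0 < c) :
    ∃ K : ℝ, 0 < K ∧ ∀ R : ℝ, 0 < R → ∀ z y : ℝ,
      (∫⁻ x in Set.Icc (z - c / R) (z + c / R), (ker (x - y)) ^ σ) ≤ ENNReal.ofReal (K * R ^ σ / R) ∧
      (z ≠ y → (∫⁻ x in Set.Icc (z - c / R) (z + c / R), (ker (x - y)) ^ σ) ≤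
        ENNReal.ofReal (K * |z - y| ^ (-σ) / R)) := by
  set A := 2 * (3 * c) ^ (1 - σ) / (1 - σ) with hA
  have hApos : 0 < A := by have : 0 < 1 - σ := by linarith
                           positivity
  set K := 2 * c * c ^ (-σ) + 2 * c * 2 ^ σ + A + A * (2 * c) ^ σ with hK
  refine ⟨K, by positivity, fun R hR z y => ?_⟩
  have hr : 0 < c / R := by positivity
  have hrs : (c / R) ^ (-σ) = c ^ (-σ) * R ^ σ := by
    rw [Real.div_rpow hc.le hR.le, Real.rpow_neg hR.le, div_inv_eq_mul]
  rcases le_or_gt (2 * (c / R)) |z - y| with hcase | hcase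
  · have hD : 0 < |z - y| := by linarith
    have key : (∫⁻ x in Set.Icc (z - c / R) (z + c / R), (ker (x - y)) ^ σ) ≤
        ENNReal.ofReal ((|z - y| / 2) ^ (-σ) * (2 * c / R)) := by
      calc _ ≤ ∫⁻ x in Set.Icc (z - c / R) (z + c / R), ENNReal.ofReal ((|z - y| / 2) ^ (-σ)) := by
            refine setLIntegral_mono' measurableSet_Icc fun x hx => ?_
            have e : |z - y| / 2 ≠ 0 := by positivity
            have := ker_rpow e σ
            rw [abs_of_pos (by positivity : 0 < |z - y| / 2)] at this
            rw [← this]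
            refine ENNReal.rpow_le_rpow (ker_anti ?_) h0
            rw [abs_of_pos (by positivity : 0 < |z - y| / 2)]
            have h3 : |z - x| ≤ c / R := abs_le.mpr ⟨by linarith [hx.2], by linarith [hx.1]⟩
            have h4 : |z - y| ≤ |z - x| + |x - y| := abs_sub_le z x y
            linarith
        _ = _ := by
            rw [setLIntegral_const, Real.volume_Icc, ← ENNReal.ofReal_mul (by positivity)]
            congr 2; ring
    constructor
    · refine key.trans (ENNReal.ofReal_le_ofReal ?_)
      have : (|z - y| / 2) ^ (-σ) ≤ (c / R) ^ (-σ) :=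
        Real.rpow_le_rpow_of_nonpos hr (by linarith) (by linarith)
      rw [hrs] at this
      calc _ ≤ (c ^ (-σ) * R ^ σ) * (2 * c / R) := by gcongr
        _ = (2 * c * c ^ (-σ)) * R ^ σ / R := by ring
        _ ≤ _ := by
          gcongr
          have : 0 < 2 * c * 2 ^ σ := by positivity
          have : 0 < A * (2 * c) ^ σ := by positivity
          linarith
    · intro _
      refine key.trans (ENNReal.ofReal_le_ofReal ?_)
      rw [Real.div_rpow hD.le (by norm_num), Real.rpow_neg (by norm_num : (0:ℝ) ≤ 2), div_inv_eq_mul]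
      calc _ = (2 * c * 2 ^ σ) * |z - y| ^ (-σ) / R := by ring
        _ ≤ _ := by
          gcongr
          have : 0 < 2 * c * c ^ (-σ) := by positivity
          have : 0 < A * (2 * c) ^ σ := by positivity
          linarith
  · have key : (∫⁻ x in Set.Icc (z - c / R) (z + c / R), (ker (x - y)) ^ σ) ≤
        ENNReal.ofReal (A * R ^ σ / R) := by
      calc _ ≤ ∫⁻ x in Set.Icc (y - 3 * c / R) (y + 3 * c / R), (ker (x - y)) ^ σ := by
            refine lintegral_mono_set ?_
            have := abs_lt.mp hcase
            have e : 3 * c / R = 3 * (c / R) := by ring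
            exact Set.Icc_subset_Icc (by linarith) (by linarith)
        _ = ∫⁻ x in Set.Icc (-(3 * c / R)) (3 * c / R), (ker x) ^ σ := by
            rw [← lintegral_indicator measurableSet_Icc, ← lintegral_indicator measurableSet_Icc,
              ← lintegral_sub_right_eq_self ((Set.Icc (-(3 * c / R)) (3 * c / R)).indicator _) y]
            congr 1; ext x
            simp only [Set.indicator, Set.mem_Icc]
            congr 1
            rw [eq_iff_iff]; constructor <;> rintro ⟨a, b⟩ <;> constructor <;> linarith
        _ ≤ _ := lint_near h1 (by positivity)
        _ = _ := by
            congr 1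
            rw [Real.div_rpow (by positivity) hR.le, Real.rpow_sub hR, Real.rpow_one, hA]
            have : 0 < 1 - σ := by linarith
            have : 0 < R ^ σ := by positivity
            field_simp
    constructor
    · refine key.trans (ENNReal.ofReal_le_ofReal ?_)
      gcongr
      have : 0 < 2 * c * c ^ (-σ) := by positivity
      have : 0 < 2 * c * 2 ^ σ := by positivity
      have : 0 < A * (2 * c) ^ σ := by positivity
      linarith
    · intro hzy
      have hD : 0 < |z - y| := abs_pos.mpr (sub_ne_zero.mpr hzy)
      refine key.trans (ENNReal.ofReal_le_ofReal ?_)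
      have h5 : R ≤ 2 * c / |z - y| := by
        rw [le_div_iff₀ hD]
        have : R * |z - y| ≤ R * (2 * (c / R)) := by gcongr
        refine this.trans (le_of_eq ?_); field_simp
      have h6 : R ^ σ ≤ (2 * c) ^ σ * |z - y| ^ (-σ) := by
        refine (Real.rpow_le_rpow hR.le h5 h0).trans (le_of_eq ?_)
        rw [Real.div_rpow (by positivity) hD.le, Real.rpow_neg hD.le]; rfl
      calc _ ≤ A * ((2 * c) ^ σ * |z - y| ^ (-σ)) / R := by gcongr
        _ = (A * (2 * c) ^ σ) * |z - y| ^ (-σ) / R := by ring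
        _ ≤ _ := by
          gcongr
          have : 0 < 2 * c * c ^ (-σ) := by positivity
          have : 0 < 2 * c * 2 ^ σ := by positivity
          linarith

lemma sum_rpow_le {σ : ℝ} (h0 : 0 ≤ σ) (h1 : σ < 1) (N : ℕ) :
    ∑ n ∈ Finset.range N, ((n : ℝ) + 1) ^ (-σ) ≤ (N : ℝ) ^ (1 - σ) / (1 - σ) := by
  have hs : 0 < 1 - σ := by linarith
  induction N with
  | zero => simp [Real.zero_rpow hs.ne']
  | succ N ih =>
    rw [Finset.sum_range_succ]
    have hN : (0 : ℝ) < (N : ℝ) + 1 := by positivity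
    have hb := rpow_one_add_le_one_add_mul_self (s := -1 / ((N : ℝ) + 1)) (p := 1 - σ)
      (by rw [le_div_iff₀ hN]; nlinarith [(Nat.cast_nonneg N : (0:ℝ) ≤ N)]) hs.le (by linarith)
    have e1 : 1 + -1 / ((N : ℝ) + 1) = N / ((N : ℝ) + 1) := by field_simp; ring
    rw [e1, Real.div_rpow (by positivity) hN.le, div_le_iff₀ (by positivity)] at hb
    have e2 : ((N : ℝ) + 1) ^ (-σ) = ((N : ℝ) + 1) ^ (1 - σ) / ((N : ℝ) + 1) := by
      rw [show -σ = (1 - σ) - 1 by ring, Real.rpow_sub hN, Real.rpow_one]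
    rw [e2]
    push_cast
    rw [le_div_iff₀ hs] at ih ⊢
    have e3 : (1 + (1 - σ) * (-1 / ((N : ℝ) + 1))) * ((N : ℝ) + 1) ^ (1 - σ) =
      ((N : ℝ) + 1) ^ (1 - σ) - ((N : ℝ) + 1) ^ (1 - σ) / ((N : ℝ) + 1) * (1 - σ) := by ring
    rw [e3] at hb
    rw [add_mul]
    linarith

lemma lattice_sum {σ : ℝ} (h0 : 0 ≤ σ) (h1 : σ < 1) {c : ℝ} (hc : 0 < c) {h : ℝ} (hh : 0 < h)
    (hh1 : h ≤ 1) (a₀ : ℤ) :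
    ∑ a ∈ (Finset.Icc (-⌊c / h⌋) ⌊c / h⌋).filter (fun a => a ≠ a₀),
      h * (|(a : ℝ) - a₀| * h) ^ (-σ) ≤ 2 / (1 - σ) + (2 * c + 1) := by
  classical
  have hs : 0 < 1 - σ := by linarith
  set N := ⌊1 / h⌋₊ with hN
  set A := (Finset.Icc (-⌊c / h⌋) ⌊c / h⌋).filter (fun a => a ≠ a₀) with hA
  set g : ℤ → ℝ := fun a => h * (|(a : ℝ) - a₀| * h) ^ (-σ) with hg
  have hgn : ∀ a, 0 ≤ g a := fun a => by positivity
  have hsplit : ∑ a ∈ A, g a ≤ ∑ a ∈ A.filter (fun a : ℤ => |(a : ℝ) - a₀| ≤ N), g a + ∑ a ∈ A, h := by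
    rw [Finset.sum_filter (s := A), ← Finset.sum_add_distrib]
    refine Finset.sum_le_sum fun a ha => ?_
    split_ifs with hif
    · linarith
    · rw [zero_add]
      have h2 : 1 ≤ |(a : ℝ) - a₀| * h := by
        have h3 : N < |a - a₀| := by
          rw [not_le] at hif; exact_mod_cast hif
        have h4 : (N : ℝ) + 1 ≤ |(a : ℝ) - a₀| := by exact_mod_cast h3
        have h5 : 1 / h < N + 1 := Nat.lt_floor_add_one _
        rw [div_lt_iff₀ hh] at h5
        nlinarith
      have := Real.rpow_le_one_of_one_le_of_nonpos h2 (by linarith : -σ ≤ 0)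
      simp only [hg]; nlinarith
  have hcard : ∑ a ∈ A, h ≤ 2 * c + 1 := by
    rw [Finset.sum_const, nsmul_eq_mul]
    have h2 : A.card ≤ (Finset.Icc (-⌊c / h⌋) ⌊c / h⌋).card := Finset.card_filter_le _ _
    rw [Int.card_Icc] at h2
    have hF : 0 ≤ ⌊c / h⌋ := Int.floor_nonneg.mpr (by positivity)
    have h3 : (A.card : ℤ) ≤ 2 * ⌊c / h⌋ + 1 := by omega
    have h4 : (A.card : ℝ) ≤ 2 * (⌊c / h⌋ : ℝ) + 1 := by exact_mod_cast h3
    have h5 : (⌊c / h⌋ : ℝ) ≤ c / h := Int.floor_le _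
    have h6 : (A.card : ℝ) ≤ 2 * (c / h) + 1 := by linarith
    calc (A.card : ℝ) * h ≤ (2 * (c / h) + 1) * h := by gcongr
      _ = 2 * c + h := by field_simp
      _ ≤ _ := by linarith
  have hhalf : ∑ n ∈ Finset.range N, h * (((n : ℝ) + 1) * h) ^ (-σ) ≤ 1 / (1 - σ) := by
    have e : ∀ n ∈ Finset.range N, h * (((n : ℝ) + 1) * h) ^ (-σ) = h ^ (1 - σ) * ((n : ℝ) + 1) ^ (-σ) := by
      intro n _
      rw [Real.mul_rpow (by positivity) hh.le, Real.rpow_sub hh, Real.rpow_one, Real.rpow_neg hh.le]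
      field_simp
    rw [Finset.sum_congr rfl e, ← Finset.mul_sum]
    calc _ ≤ h ^ (1 - σ) * ((N : ℝ) ^ (1 - σ) / (1 - σ)) := by
          gcongr; exact sum_rpow_le h0 h1 N
      _ = (h * N) ^ (1 - σ) / (1 - σ) := by rw [Real.mul_rpow hh.le (by positivity)]; ring
      _ ≤ _ := by
          gcongr
          apply Real.rpow_le_one (by positivity) _ hs.le
          have : (N : ℝ) ≤ 1 / h := Nat.floor_le (by positivity)
          rw [le_div_iff₀ hh] at this; linarith
  have hnear : ∑ a ∈ A.filter (fun a : ℤ => |(a : ℝ) - a₀| ≤ N), g a ≤ 2 / (1 - σ) := by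
    have hsub : A.filter (fun a : ℤ => |(a : ℝ) - a₀| ≤ N) ⊆
        (Finset.range N).image (fun n : ℕ => a₀ + (n + 1)) ∪
        (Finset.range N).image (fun n : ℕ => a₀ - (n + 1)) := by
      intro a ha
      simp only [hA, Finset.mem_filter] at ha
      obtain ⟨⟨_, hne⟩, hle⟩ := ha
      have hle' : |a - a₀| ≤ (N : ℤ) := by exact_mod_cast hle
      rw [abs_le] at hle'
      simp only [Finset.mem_union, Finset.mem_image, Finset.mem_range]
      rcases lt_or_gt_of_ne hne with hlt | hlt
      · right; exact ⟨(a₀ - a - 1).toNat, by omega, by omega⟩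
      · left; exact ⟨(a - a₀ - 1).toNat, by omega, by omega⟩
    have hu : ∀ s t : Finset ℤ, ∑ a ∈ s ∪ t, g a ≤ ∑ a ∈ s, g a + ∑ a ∈ t, g a := by
      intro s t
      rw [← Finset.sum_union_inter]
      have : 0 ≤ ∑ a ∈ s ∩ t, g a := Finset.sum_nonneg fun a _ => hgn a
      linarith
    refine (Finset.sum_le_sum_of_subset_of_nonneg hsub fun a _ _ => hgn a).trans ((hu _ _).trans ?_)
    rw [Finset.sum_image (fun x _ y _ hxy => by simpa using hxy),
      Finset.sum_image (fun x _ y _ hxy => by simpa using hxy)]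
    have e1 : ∀ n ∈ Finset.range N, g (a₀ + ((n : ℤ) + 1)) = h * (((n : ℝ) + 1) * h) ^ (-σ) := by
      intro n _
      simp only [hg]
      push_cast
      rw [add_sub_cancel_left, abs_of_nonneg (by positivity)]
    have e2 : ∀ n ∈ Finset.range N, g (a₀ - ((n : ℤ) + 1)) = h * (((n : ℝ) + 1) * h) ^ (-σ) := by
      intro n _
      simp only [hg]
      push_cast
      rw [sub_sub_cancel_left, abs_neg, abs_of_nonneg (by positivity)]
    rw [Finset.sum_congr rfl e1, Finset.sum_congr rfl e2]
    calc _ ≤ 1 / (1 - σ) + 1 / (1 - σ) := add_le_add hhalf hhalf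
      _ = _ := by ring
  linarith

lemma lint_nu (c h R : ℝ) (f : ℝ → ENNReal) (hf : Measurable f) :
    ∫⁻ x, f x * nu c h R x = ENNReal.ofReal (h * R) * ∑ a ∈ Finset.Icc (-⌊c / h⌋) ⌊c / h⌋,
      ∫⁻ x in Set.Icc ((a : ℝ) * h - c / R) ((a : ℝ) * h + c / R), f x := by
  have e : ∀ x, f x * nu c h R x = ENNReal.ofReal (h * R) * ∑ a ∈ Finset.Icc (-⌊c / h⌋) ⌊c / h⌋,
      (Set.Icc ((a : ℝ) * h - c / R) ((a : ℝ) * h + c / R)).indicator f x := by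
    intro x
    rw [nu, mul_left_comm, Finset.mul_sum]
    congr 1
    refine Finset.sum_congr rfl fun a _ => ?_
    simp only [Set.indicator]
    split_ifs <;> simp
  simp_rw [e]
  rw [lintegral_const_mul _ (Finset.measurable_fun_sum _ fun a _ => hf.indicator measurableSet_Icc),
    lintegral_finsetSum _ fun a _ => hf.indicator measurableSet_Icc]
  congr 1
  exact Finset.sum_congr rfl fun a _ => lintegral_indicator measurableSet_Icc _

lemma potT {σ : ℝ} (h0 : 0 ≤ σ) (h1 : σ < 1) {c : ℝ} (hc : 0 < c) :
    ∃ K : ℝ, 0 < K ∧ ∀ h R : ℝ, 0 < h → h ≤ 1 → 0 < R → h * R ^ σ ≤ 1 → ∀ y : ℝ,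
      ∫⁻ x, (ker (x - y)) ^ σ * nu c h R x ≤ ENNReal.ofReal K := by
  obtain ⟨K, hK, hw⟩ := window h0 h1 hc
  have hs : 0 < 1 - σ := by linarith
  refine ⟨K + K * 2 ^ σ * (2 / (1 - σ) + (2 * c + 1)), by positivity, ?_⟩
  intro h R hh hh1 hR hhR y
  rw [lint_nu _ _ _ (fun x => ker (x - y) ^ σ) ((measurable_ker.comp (measurable_id.sub_const y)).pow_const σ), Finset.mul_sum]
  set a₀ := round (y / h) with ha₀
  have hterm : ∀ a : ℤ, ENNReal.ofReal (h * R) *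
      ∫⁻ x in Set.Icc ((a : ℝ) * h - c / R) ((a : ℝ) * h + c / R), ker (x - y) ^ σ ≤
      ENNReal.ofReal ((if a = a₀ then K else 0) +
        (if a ≠ a₀ then K * 2 ^ σ * (h * (|(a : ℝ) - a₀| * h) ^ (-σ)) else 0)) := by
    intro a
    by_cases ha : a = a₀
    · simp only [ha, if_true, ne_eq, not_true, if_false, add_zero]
      refine (mul_le_mul_right (hw R hR _ y).1 _).trans ?_
      rw [← ENNReal.ofReal_mul (by positivity)]
      apply ENNReal.ofReal_le_ofReal
      calc _ = K * (h * R ^ σ) := by field_simp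
        _ ≤ K * 1 := by gcongr
        _ = K := mul_one K
    · simp only [ha, if_false, ne_eq, not_false_eq_true, if_true, zero_add]
      have hr : |y / h - a₀| ≤ 1 / 2 := abs_sub_round _
      have h1a : (1 : ℝ) ≤ |(a : ℝ) - a₀| := by
        have : 1 ≤ |a - a₀| := Int.one_le_abs (sub_ne_zero.mpr ha)
        exact_mod_cast this
      have h2 : |(a : ℝ) - a₀| ≤ |(a : ℝ) - y / h| + |y / h - a₀| := abs_sub_le _ _ _
      have h3 : |(a : ℝ) - a₀| / 2 ≤ |(a : ℝ) - y / h| := by linarith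
      have h4 : |(a : ℝ) * h - y| = |(a : ℝ) - y / h| * h := by
        rw [← abs_of_pos hh, ← abs_mul, abs_of_pos hh]; congr 1; field_simp
      have h5 : |(a : ℝ) - a₀| * h / 2 ≤ |(a : ℝ) * h - y| := by rw [h4]; nlinarith
      have hpos : 0 < |(a : ℝ) - a₀| * h := by positivity
      have hne : (a : ℝ) * h ≠ y := by
        intro h'; rw [h', sub_self, abs_zero] at h5; linarith
      refine (mul_le_mul_right ((hw R hR _ y).2 hne) _).trans ?_
      rw [← ENNReal.ofReal_mul (by positivity)]
      apply ENNReal.ofReal_le_ofReal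
      have h6 := Real.rpow_le_rpow_of_nonpos (by positivity) h5 (by linarith : -σ ≤ 0)
      rw [Real.div_rpow hpos.le (by norm_num), Real.rpow_neg (by norm_num : (0:ℝ) ≤ 2), div_inv_eq_mul] at h6
      calc _ = K * h * |(a : ℝ) * h - y| ^ (-σ) := by field_simp
        _ ≤ K * h * ((|(a : ℝ) - a₀| * h) ^ (-σ) * 2 ^ σ) := by gcongr
        _ = _ := by ring
  refine (Finset.sum_le_sum fun a _ => hterm a).trans ?_
  rw [← ENNReal.ofReal_sum_of_nonneg]
  · apply ENNReal.ofReal_le_ofReal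
    rw [Finset.sum_add_distrib, Finset.sum_ite_eq', ← Finset.sum_filter, ← Finset.mul_sum]
    refine add_le_add ?_ (by gcongr; exact lattice_sum h0 h1 hc hh hh1 a₀)
    split_ifs <;> linarith
  · intro a _
    have : 0 ≤ K * 2 ^ σ * (h * (|(a : ℝ) - a₀| * h) ^ (-σ)) := by positivity
    split_ifs <;> linarith

lemma nu_bdd {c h R : ℝ} (hc : 0 < c) (hh : 0 < h) (hhR : h * R = 1) (x : ℝ) :
    nu c h R x ≤ ENNReal.ofReal (2 * c + 1) := by
  have hR : R = 1 / h := by field_simp; linarith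
  rw [nu, hhR, ENNReal.ofReal_one, one_mul]
  have e : ∀ a ∈ Finset.Icc (-⌊c / h⌋) ⌊c / h⌋,
      (Set.Icc ((a : ℝ) * h - c / R) ((a : ℝ) * h + c / R)).indicator (1 : ℝ → ENNReal) x ≤
      if a ∈ Finset.Icc ⌈x / h - c⌉ ⌊x / h + c⌋ then 1 else 0 := by
    intro a _
    by_cases hx : x ∈ Set.Icc ((a : ℝ) * h - c / R) ((a : ℝ) * h + c / R)
    · have e1 : c / R = c * h := by rw [hR]; field_simp
      rw [e1] at hx
      have m : a ∈ Finset.Icc ⌈x / h - c⌉ ⌊x / h + c⌋ := by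
        rw [Finset.mem_Icc, Int.ceil_le, Int.le_floor]
        constructor
        · rw [sub_le_iff_le_add, div_le_iff₀ hh]; linarith [hx.2]
        · rw [← sub_le_iff_le_add, le_div_iff₀ hh]; linarith [hx.1]
      rw [if_pos m]
      exact Set.indicator_le_self' (fun _ _ => zero_le) x
    · rw [Set.indicator_of_notMem hx]; exact zero_le
  refine (Finset.sum_le_sum e).trans ?_
  rw [← Finset.sum_filter, Finset.sum_const, nsmul_eq_mul, mul_one]
  have h2 : ((Finset.Icc (-⌊c / h⌋) ⌊c / h⌋).filter (fun a => a ∈ Finset.Icc ⌈x / h - c⌉ ⌊x / h + c⌋)).card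
      ≤ (Finset.Icc ⌈x / h - c⌉ ⌊x / h + c⌋).card := by
    apply Finset.card_le_card
    intro a ha
    exact (Finset.mem_filter.mp ha).2
  rw [Int.card_Icc] at h2
  have h3 : (((⌊x / h + c⌋ + 1 - ⌈x / h - c⌉).toNat : ℕ) : ℝ) ≤ 2 * c + 1 := by
    have h4 : (⌊x / h + c⌋ : ℝ) ≤ x / h + c := Int.floor_le _
    have h5 : x / h - c ≤ (⌈x / h - c⌉ : ℝ) := Int.le_ceil _
    rcases le_total 0 (⌊x / h + c⌋ + 1 - ⌈x / h - c⌉) with h6 | h6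
    · have h7 : (((⌊x / h + c⌋ + 1 - ⌈x / h - c⌉).toNat : ℕ) : ℤ) = ⌊x / h + c⌋ + 1 - ⌈x / h - c⌉ :=
        Int.toNat_of_nonneg h6
      have h8 : (((⌊x / h + c⌋ + 1 - ⌈x / h - c⌉).toNat : ℕ) : ℝ) = ⌊x / h + c⌋ + 1 - ⌈x / h - c⌉ := by
        exact_mod_cast h7
      rw [h8]; linarith
    · rw [Int.toNat_of_nonpos h6]; push_cast; linarith
  rw [← ENNReal.ofReal_natCast]
  apply ENNReal.ofReal_le_ofReal
  have : ((_ : ℕ) : ℝ) ≤ _ := Nat.cast_le.mpr h2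
  linarith

lemma potS {ε : ℝ} (hε : 0 < ε) {c : ℝ} (hc : 0 < c) :
    ∃ K : ℝ, 0 < K ∧ ∀ h R : ℝ, 0 < h → h * R = 1 → ∀ y w : ℝ,
      ∫⁻ x, (ker (max |x - y| |w|)) ^ (1 + ε) * nu c h R x ≤ ENNReal.ofReal K * (ker w) ^ ε := by
  refine ⟨(2 * c + 1) * (2 + 2 / ε), by positivity, fun h R hh hhR y w => ?_⟩
  have hm : Measurable fun x : ℝ => (ker (max |x| |w|)) ^ (1 + ε) :=
    (measurable_ker.comp (by fun_prop)).pow_const _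
  calc _ ≤ ∫⁻ x, ENNReal.ofReal (2 * c + 1) * (ker (max |x - y| |w|)) ^ (1 + ε) := by
        refine lintegral_mono fun x => ?_
        rw [mul_comm]
        gcongr
        exact nu_bdd hc hh hhR x
    _ = ENNReal.ofReal (2 * c + 1) * ∫⁻ x, (ker (max |x| |w|)) ^ (1 + ε) := by
        rw [lintegral_sub_right_eq_self
          (fun x => ENNReal.ofReal (2 * c + 1) * (ker (max |x| |w|)) ^ (1 + ε)) y,
          lintegral_const_mul _ hm]
    _ ≤ ENNReal.ofReal (2 * c + 1) * (ENNReal.ofReal (2 + 2 / ε) * (ker w) ^ ε) := by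
        gcongr; exact lint_max hε w
    _ = _ := by rw [← mul_assoc, ← ENNReal.ofReal_mul (by positivity)]

lemma lint_pi_prod (n : ℕ) (f : Fin n → ℝ → ENNReal) (hf : ∀ j, Measurable (f j)) :
    ∫⁻ x : Fin n → ℝ, ∏ j, f j (x j) = ∏ j, ∫⁻ u, f j u := by
  induction n with
  | zero => simp [lintegral_unique, volume_pi]
  | succ n ih =>
    have hmp := (volume_preserving_piFinSuccAbove (fun _ : Fin (n + 1) => ℝ) 0).symm
    rw [MeasurePreserving.lintegral_map_equiv _ _ hmp, Measure.volume_eq_prod, lintegral_prod]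
    · simp only [Fin.prod_univ_succ, MeasurableEquiv.piFinSuccAbove_symm_apply, Fin.insertNthEquiv,
        Equiv.coe_fn_mk, Fin.insertNth_zero', Fin.cons_zero, Fin.cons_succ]
      have hm : Measurable fun z : Fin n → ℝ => ∏ j, f j.succ (z j) :=
        Finset.measurable_fun_prod _ fun j _ => (hf _).comp (measurable_pi_apply j)
      refine (lintegral_congr fun u => lintegral_const_mul (f 0 u) hm).trans ?_
      rw [lintegral_mul_const _ (hf 0), ih (fun j => f j.succ) fun j => hf _]
    · refine Measurable.aemeasurable ?_
      refine Finset.measurable_fun_prod _ fun j _ => (hf _).comp ?_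
      exact (measurable_pi_apply j).comp (MeasurableEquiv.measurable _)

lemma rpow_finset_sum {ι : Type*} (S : Finset ι) (x : ENNReal) (t : ι → ℝ) (ht : ∀ j, 0 ≤ t j) :
    x ^ (∑ j ∈ S, t j) = ∏ j ∈ S, x ^ (t j) := by
  classical
  induction S using Finset.induction_on with
  | empty => simp
  | insert a S ha ih =>
    rw [Finset.sum_insert ha, Finset.prod_insert ha,
      ENNReal.rpow_add_of_nonneg _ _ (ht a) (Finset.sum_nonneg fun j _ => ht j), ih]

lemma pot_pi (n : ℕ) (i : Fin (n + 1)) (t e : Fin (n + 1) → ℝ) (ht : ∀ j, 0 ≤ t j)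
    (he : ∀ j, 0 ≤ e j) (ν : Fin (n + 1) → ℝ → ENNReal) (hν : ∀ j, Measurable (ν j))
    (y : Fin (n + 1) → ℝ) (K : ENNReal)
    (h1 : ∀ j, j ≠ i → ∀ w, ∫⁻ u, (ker (max |u - y j| |w|)) ^ (t j) * ν j u ≤ K * (ker w) ^ (e j))
    (h2 : ∫⁻ u, (ker (u - y i)) ^ (t i + ∑ j : Fin n, e (i.succAbove j)) * ν i u ≤ K) :
    ∫⁻ x : Fin (n + 1) → ℝ, ∏ j, ((ker (max |x j - y j| |x i - y i|)) ^ (t j) * ν j (x j))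
      ≤ K ^ (n + 1) := by
  have hmp := (volume_preserving_piFinSuccAbove (fun _ : Fin (n + 1) => ℝ) i).symm
  rw [MeasurePreserving.lintegral_map_equiv _ _ hmp, Measure.volume_eq_prod, lintegral_prod]
  · simp only [Fin.prod_univ_succAbove _ i, MeasurableEquiv.piFinSuccAbove_symm_apply,
      Fin.insertNthEquiv, Equiv.coe_fn_mk, Fin.insertNth_apply_same, Fin.insertNth_apply_succAbove]
    have hmj : ∀ (u : ℝ) (j : Fin n), Measurable fun v : ℝ =>
        ker (max |v - y (i.succAbove j)| |u - y i|) ^ t (i.succAbove j) * ν (i.succAbove j) v :=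
      fun u j => ((measurable_ker.comp (by fun_prop)).pow_const _).mul (hν _)
    have hstep : ∀ u : ℝ, (∫⁻ z : Fin n → ℝ,
        (ker (max |u - y i| |u - y i|) ^ t i * ν i u *
        ∏ j : Fin n, (ker (max |z j - y (i.succAbove j)| |u - y i|) ^ t (i.succAbove j) *
          ν (i.succAbove j) (z j)))) ≤
        K ^ n * ((ker (u - y i)) ^ (t i + ∑ j : Fin n, e (i.succAbove j)) * ν i u) := by
      intro u
      have hmz : Measurable fun z : Fin n → ℝ =>
          ∏ j : Fin n, (ker (max |z j - y (i.succAbove j)| |u - y i|) ^ t (i.succAbove j) *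
          ν (i.succAbove j) (z j)) :=
        Finset.measurable_fun_prod _ fun j _ => (hmj u j).comp (measurable_pi_apply j)
      rw [lintegral_const_mul _ hmz,
        lint_pi_prod n (fun j v => ker (max |v - y (i.succAbove j)| |u - y i|) ^ t (i.succAbove j) *
          ν (i.succAbove j) v) (hmj u)]
      have hk : ker (max |u - y i| |u - y i|) = ker (u - y i) := by simp [ker]
      rw [hk]
      calc _ ≤ ker (u - y i) ^ t i * ν i u * ∏ j : Fin n, (K * ker (u - y i) ^ e (i.succAbove j)) := by
            gcongr with j
            exact h1 _ (Fin.succAbove_ne i j) (u - y i)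
        _ = _ := by
            rw [Finset.prod_mul_distrib, Finset.prod_const, Finset.card_univ, Fintype.card_fin,
              ENNReal.rpow_add_of_nonneg _ _ (ht i) (Finset.sum_nonneg fun j _ => he _),
              rpow_finset_sum _ _ _ fun j => he _]
            ring
    refine (lintegral_mono hstep).trans ?_
    have hmu : Measurable fun u : ℝ =>
        (ker (u - y i)) ^ (t i + ∑ j : Fin n, e (i.succAbove j)) * ν i u :=
      ((measurable_ker.comp (measurable_id.sub_const _)).pow_const _).mul (hν i)
    rw [lintegral_const_mul _ hmu,
      pow_succ]
    gcongr
  · refine Measurable.aemeasurable ?_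
    have : Measurable fun x : Fin (n + 1) → ℝ =>
        ∏ j, ((ker (max |x j - y j| |x i - y i|)) ^ (t j) * ν j (x j)) :=
      Finset.measurable_fun_prod _ fun j _ => ((measurable_ker.comp (by fun_prop)).pow_const _).mul
        ((hν _).comp (measurable_pi_apply j))
    exact this.comp (MeasurableEquiv.measurable _)

lemma muQ_le (d : ℕ) (s : ℝ) (hs : 0 < s) (α : Fin d → ℝ) (hsumα : ∑ j, α j = (d : ℝ))
    (ψ₀ : ℝ → ℝ) (C₀ : ℝ) (hC₀ : 2 < C₀) (B : ℝ) (hB : ∀ x, ψ₀ x ≤ B)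
    (hψ₀nonneg : ∀ x : ℝ, 0 ≤ ψ₀ x)
    (hψ₀zero : ∀ x : ℝ, C₀ ≤ |x| → ψ₀ x = 0) (q : ℝ) (hq : 1 ≤ q) (x : Euc d) :
    0 ≤ muQ d s α ψ₀ q x ∧ ENNReal.ofReal (muQ d s α ψ₀ q x) ≤
      ENNReal.ofReal ((B * B) ^ d) * ∏ j, nu C₀ (q ^ (-α j)) (q ^ ((d : ℝ) / s)) (x j) := by
  have hq0 : 0 < q := by linarith
  have hB0 : 0 ≤ B := (hψ₀nonneg 0).trans (hB 0)
  set R := q ^ ((d : ℝ) / s) with hR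
  have hRpos : 0 < R := by positivity
  set g : Fin d → ℤ → ℝ := fun j a =>
    ψ₀ ((a : ℝ) / q ^ (α j)) * ψ₀ (R * (x j - (a : ℝ) / q ^ (α j))) with hg
  set A : Fin d → Finset ℤ := fun j => Finset.Icc (-⌊C₀ / q ^ (-α j)⌋) ⌊C₀ / q ^ (-α j)⌋ with hA
  have hg0 : ∀ j a, 0 ≤ g j a := fun j a => mul_nonneg (hψ₀nonneg _) (hψ₀nonneg _)
  have hgA : ∀ j a, a ∉ A j → g j a = 0 := by
    intro j a ha
    simp only [hg]
    rw [hψ₀zero, zero_mul]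
    by_contra hlt
    rw [not_le, abs_div, abs_of_pos (by positivity : 0 < q ^ α j), div_lt_iff₀ (by positivity)] at hlt
    apply ha
    simp only [hA, Finset.mem_Icc]
    have e : C₀ / q ^ (-α j) = C₀ * q ^ α j := by rw [Real.rpow_neg hq0.le, div_inv_eq_mul]
    rw [e]
    have := abs_lt.mp hlt
    constructor
    · rw [neg_le, Int.le_floor]; push_cast; linarith
    · rw [Int.le_floor]; linarith
  have htsum : ∑' a : Fin d → ℤ, ∏ j, g j (a j) = ∏ j, ∑ a ∈ A j, g j a := by
    rw [Finset.prod_univ_sum, tsum_eq_sum]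
    intro a ha
    rw [Fintype.mem_piFinset, not_forall] at ha
    obtain ⟨j, hj⟩ := ha
    exact Finset.prod_eq_zero (Finset.mem_univ j) (hgA j _ hj)
  have hpre : q ^ (-(d : ℝ)) * q ^ ((d : ℝ) ^ 2 / s) = ∏ j : Fin d, (q ^ (-α j) * R) := by
    rw [Finset.prod_mul_distrib, Finset.prod_const, Finset.card_univ, Fintype.card_fin,
      ← Real.rpow_sum_of_pos hq0, Finset.sum_neg_distrib, hsumα, hR, ← Real.rpow_natCast (q ^ ((d : ℝ) / s)),
      ← Real.rpow_mul hq0.le]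
    congr 2; ring
  have hmu : muQ d s α ψ₀ q x = ∏ j, (q ^ (-α j) * R * ∑ a ∈ A j, g j a) := by
    rw [Finset.prod_mul_distrib, ← hpre, ← htsum]; rfl
  have hfac : ∀ j, 0 ≤ q ^ (-α j) * R * ∑ a ∈ A j, g j a := fun j =>
    mul_nonneg (by positivity) (Finset.sum_nonneg fun a _ => hg0 j a)
  refine ⟨hmu ▸ Finset.prod_nonneg fun j _ => hfac j, ?_⟩
  rw [hmu, ENNReal.ofReal_prod_of_nonneg fun j _ => hfac j, ENNReal.ofReal_pow (by positivity)]
  have hc : ENNReal.ofReal (B * B) ^ d = ∏ _j : Fin d, ENNReal.ofReal (B * B) := by simp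
  rw [hc, ← Finset.prod_mul_distrib]
  refine Finset.prod_le_prod' fun j _ => ?_
  rw [nu, mul_left_comm, ENNReal.ofReal_mul (by positivity),
    ENNReal.ofReal_sum_of_nonneg fun a _ => hg0 j a]
  refine mul_le_mul_right ?_ _
  rw [Finset.mul_sum]
  refine Finset.sum_le_sum fun a ha => ?_
  by_cases hx : x j ∈ Set.Icc ((a : ℝ) * q ^ (-α j) - C₀ / R) ((a : ℝ) * q ^ (-α j) + C₀ / R)
  · rw [Set.indicator_of_mem hx, Pi.one_apply, mul_one]
    apply ENNReal.ofReal_le_ofReal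
    exact mul_le_mul (hB _) (hB _) (hψ₀nonneg _) hB0
  · have : g j a = 0 := by
      simp only [hg]
      rw [hψ₀zero (R * _), mul_zero]
      by_contra hlt
      rw [not_le, abs_mul, abs_of_pos hRpos, mul_comm, ← lt_div_iff₀ hRpos] at hlt
      apply hx
      have e : (a : ℝ) / q ^ α j = a * q ^ (-α j) := by rw [Real.rpow_neg hq0.le]; rfl
      rw [e] at hlt
      have := abs_lt.mp hlt
      exact ⟨by linarith, by linarith⟩
    rw [this]; simp

lemma ofReal_norm_le_ker (r s : ℝ) (hr : 0 ≤ r) (hs : 0 < s) :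
    ENNReal.ofReal (r ^ (-s)) ≤ ker r ^ s := by
  by_cases h : r = 0
  · subst h; rw [Real.zero_rpow (by linarith)]; simp
  · rw [ker_rpow h, abs_of_nonneg hr]

lemma lint_euc (n : ℕ) (f : (Fin n → ℝ) → ENNReal) :
    ∫⁻ x : Euc n, f (fun j => x j) = ∫⁻ x : Fin n → ℝ, f x :=
  (MeasurePreserving.lintegral_map_equiv f _
    (EuclideanSpace.volume_preserving_symm_measurableEquiv_toLp (Fin n))).symm

/-- The energy lemma: the Riesz `s`-energy of `μ_q` is bounded uniformly in `q`:
`∬ |x − y|^{−s} μ_q(x) μ_q(y) dx dy ≤ C`. -/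
theorem energy_lemma
    (d : ℕ) (hd : 2 ≤ d) (s : ℝ) (hs₁ : ((d : ℝ) + 1) / 2 ≤ s) (hs₂ : s < d)
    (α : Fin d → ℝ) (hα : ∀ j, 0 < α j) (hsumα : ∑ j, α j = (d : ℝ))
    (hαle : ∀ j, α j ≤ (d : ℝ) / s)
    (ψ₀ : ℝ → ℝ) (C₀ : ℝ) (hC₀ : 2 < C₀)
    (hψ₀smooth : ContDiff ℝ (⊤ : ℕ∞) ψ₀) (hψ₀even : ∀ x : ℝ, ψ₀ (-x) = ψ₀ x)
    (hψ₀nonneg : ∀ x : ℝ, 0 ≤ ψ₀ x)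
    (hψ₀one : ∀ x : ℝ, |x| ≤ 1 → ψ₀ x = 1)
    (hψ₀zero : ∀ x : ℝ, C₀ ≤ |x| → ψ₀ x = 0) :
    ∃ C > (0 : ℝ), ∀ q : ℝ, 1 ≤ q →
      ∫ p : Euc d × Euc d,
          ‖p.1 - p.2‖ ^ (-s) * muQ d s α ψ₀ q p.1 * muQ d s α ψ₀ q p.2 ≤ C := by
  obtain ⟨n, rfl⟩ : ∃ n, d = n + 1 := ⟨d - 1, by omega⟩
  set D : ℝ := ((n + 1 : ℕ) : ℝ) with hDdef
  have hD : 2 ≤ D := by rw [hDdef]; exact_mod_cast hd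
  have hD0 : 0 < D := by linarith
  have hs : 0 < s := by linarith
  have hc : 0 < C₀ := by linarith
  -- the bound for the bump function
  obtain ⟨B, hB⟩ : ∃ B, ∀ x, ψ₀ x ≤ B := by
    have hcomp : HasCompactSupport ψ₀ := by
      refine HasCompactSupport.intro (isCompact_Icc (a := -C₀) (b := C₀)) fun x hx => ?_
      apply hψ₀zero
      by_contra h
      rw [not_le, abs_lt] at h
      exact hx ⟨h.1.le, h.2.le⟩
    obtain ⟨B, hB⟩ := hψ₀smooth.continuous.bounded_above_of_compact_support hcomp
    exact ⟨B, fun x => (le_abs_self _).trans (hB x)⟩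
  -- a coordinate with strict inequality
  obtain ⟨i, hi⟩ : ∃ i, α i < D / s := by
    by_contra hcon
    simp only [not_exists, not_lt] at hcon
    have h1 : ∑ _j : Fin (n + 1), D / s ≤ ∑ j, α j := Finset.sum_le_sum fun j _ => hcon j
    rw [hsumα, Finset.sum_const, Finset.card_univ, Fintype.card_fin, nsmul_eq_mul, ← hDdef,
      mul_div_assoc', div_le_iff₀ hs] at h1
    nlinarith
  set σ : Fin (n + 1) → ℝ := fun j => α j * s / D with hσ
  have hσpos : ∀ j, 0 < σ j := fun j => by have := hα j; positivity
  have hσlt : ∀ j, α j ≠ D / s → σ j < 1 := by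
    intro j hj
    have h1 : α j < D / s := lt_of_le_of_ne (hαle j) hj
    rw [lt_div_iff₀ hs] at h1
    simp only [hσ]
    rw [div_lt_one hD0]; exact h1
  have hσsum : ∑ j, σ j = s := by
    simp only [hσ]
    rw [← Finset.sum_div, ← Finset.sum_mul, hsumα]; field_simp
  set δ : ℝ := σ i / D with hδ
  have hδpos : 0 < δ := by have := hσpos i; positivity
  set e : Fin (n + 1) → ℝ := fun j => if α j = D / s then δ else 0 with he
  have he0 : ∀ j, 0 ≤ e j := fun j => by simp only [he]; split_ifs <;> linarith
  have heδ : ∀ j, e j ≤ δ := fun j => by simp only [he]; split_ifs <;> linarith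
  set E : ℝ := ∑ j : Fin n, e (i.succAbove j) with hE
  have hEle : E ≤ σ i := by
    have h1 : E ≤ ∑ _j : Fin n, δ := Finset.sum_le_sum fun j _ => heδ _
    rw [Finset.sum_const, Finset.card_univ, Fintype.card_fin, nsmul_eq_mul] at h1
    have h2 : (n : ℝ) ≤ D := by rw [hDdef]; push_cast; linarith
    calc E ≤ n * δ := h1
      _ ≤ D * δ := by gcongr
      _ = σ i := by rw [hδ]; field_simp
  set t : Fin (n + 1) → ℝ := fun j => if j = i then σ i - E else σ j + e j with ht
  have ht0 : ∀ j, 0 ≤ t j := fun j => by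
    simp only [ht]; split_ifs
    · linarith
    · have := hσpos j; have := he0 j; linarith
  have hti : t i = σ i - E := by simp [ht]
  have htj : ∀ j, j ≠ i → t j = σ j + e j := fun j hj => by simp [ht, hj]
  have htsum : ∑ j, t j = s := by
    rw [Fin.sum_univ_succAbove _ i, hti,
      Finset.sum_congr rfl fun j _ => htj _ (Fin.succAbove_ne i j), Finset.sum_add_distrib, ← hE,
      ← hσsum, Fin.sum_univ_succAbove σ i]
    ring
  have hhR : ∀ q : ℝ, 1 ≤ q → ∀ j, q ^ (-α j) * (q ^ (D / s)) ^ (σ j) = 1 := by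
    intro q hq j
    have hq0 : 0 < q := by linarith
    rw [← Real.rpow_mul hq0.le, ← Real.rpow_add hq0]
    have : -α j + D / s * σ j = 0 := by simp only [hσ]; field_simp; ring
    rw [this, Real.rpow_zero]
  have hh1 : ∀ q : ℝ, 1 ≤ q → ∀ j, q ^ (-α j) ≤ 1 := fun q hq j =>
    Real.rpow_le_one_of_one_le_of_nonpos hq (by linarith [hα j])
  -- one dimensional potentials
  have hP : ∀ j, ∃ K : ℝ, 0 < K ∧ ∀ q : ℝ, 1 ≤ q → ∀ y w : ℝ,
      ∫⁻ u, (ker (max |u - y| |w|)) ^ (σ j + e j) * nu C₀ (q ^ (-α j)) (q ^ (D / s)) u ≤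
        ENNReal.ofReal K * (ker w) ^ (e j) := by
    intro j
    by_cases hj : α j = D / s
    · obtain ⟨K, hK, hb⟩ := potS hδpos hc
      refine ⟨K, hK, fun q hq y w => ?_⟩
      have hq0 : 0 < q := by linarith
      have h1 : σ j = 1 := by simp only [hσ, hj]; field_simp
      have h2 : e j = δ := by simp [he, hj]
      have h3 := hhR q hq j
      rw [h1, Real.rpow_one] at h3
      rw [h1, h2]
      exact hb _ _ (by positivity) h3 y w
    · obtain ⟨K, hK, hb⟩ := potT (hσpos j).le (hσlt j hj) hc
      refine ⟨K, hK, fun q hq y w => ?_⟩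
      have hq0 : 0 < q := by linarith
      have h2 : e j = 0 := by simp [he, hj]
      rw [h2, add_zero, ENNReal.rpow_zero, mul_one]
      refine le_trans (lintegral_mono fun u => ?_)
        (hb _ _ (by positivity) (hh1 q hq j) (by positivity) (hhR q hq j).le y)
      refine mul_le_mul_left (ENNReal.rpow_le_rpow (ker_anti ?_) (hσpos j).le) _
      exact (le_max_left _ _).trans (le_abs_self _)
  choose KP hKP hPb using hP
  obtain ⟨Ki, hKi, hPi⟩ := potT (hσpos i).le (hσlt i hi.ne) hc
  obtain ⟨KM, hKM, hM⟩ := potT (le_refl (0:ℝ)) one_pos hc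
  set K : ℝ := Ki + ∑ j, KP j with hK
  have hKPsum : 0 ≤ ∑ j, KP j := Finset.sum_nonneg fun j _ => (hKP j).le
  have hKpos : 0 < K := by linarith
  set BB : ℝ := (B * B) ^ (n + 1) with hBB
  have hBB0 : 0 ≤ BB := pow_nonneg (mul_self_nonneg B) _
  refine ⟨BB * BB * K ^ (n + 1) * KM ^ (n + 1) + 1, by positivity, fun q hq => ?_⟩
  have hq0 : 0 < q := by linarith
  set ν : Fin (n + 1) → ℝ → ENNReal := fun j => nu C₀ (q ^ (-α j)) (q ^ (D / s)) with hν
  have hνm : ∀ j, Measurable (ν j) := fun j => measurable_nu _ _ _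
  set Nf : Euc (n + 1) → ENNReal := fun x => ∏ j, ν j (x j) with hNf
  have hNfm : Measurable Nf := Finset.measurable_fun_prod _ fun j _ => (hνm j).comp (by fun_prop)
  have hmu := muQ_le (n + 1) s hs α hsumα ψ₀ C₀ hC₀ B hB hψ₀nonneg hψ₀zero q hq
  have hmass : ∫⁻ x, Nf x ≤ ENNReal.ofReal (KM ^ (n + 1)) := by
    rw [hNf, lint_euc (n + 1) (fun x => ∏ j, ν j (x j)), lint_pi_prod _ _ hνm,
      ENNReal.ofReal_pow hKM.le]
    calc _ ≤ ∏ _j : Fin (n + 1), ENNReal.ofReal KM := by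
          refine Finset.prod_le_prod' fun j _ => ?_
          have := hM (q ^ (-α j)) (q ^ (D / s)) (by positivity) (hh1 q hq j) (by positivity)
            (by rw [Real.rpow_zero, mul_one]; exact hh1 q hq j) 0
          simpa using this
      _ = _ := by simp
  have hpot : ∀ y : Euc (n + 1), ∫⁻ x : Euc (n + 1), ker ‖x - y‖ ^ s * Nf x ≤
      ENNReal.ofReal (K ^ (n + 1)) := by
    intro y
    have hb := pot_pi n i t e ht0 he0 ν hνm (fun j => y j) (ENNReal.ofReal K) (by
        intro j hj w
        rw [htj j hj]
        refine (hPb j q hq (y j) w).trans ?_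
        refine mul_le_mul_left (ENNReal.ofReal_le_ofReal ?_) _
        have := Finset.single_le_sum (fun j _ => (hKP j).le) (Finset.mem_univ j)
        linarith) (by
        rw [hti, ← hE, sub_add_cancel]
        refine (hPi _ _ (by positivity) (hh1 q hq i) (by positivity) (hhR q hq i).le (y i)).trans ?_
        exact ENNReal.ofReal_le_ofReal (by linarith))
    rw [← lint_euc] at hb
    rw [ENNReal.ofReal_pow hKpos.le]
    refine le_trans (lintegral_mono fun x => ?_) hb
    simp only [hNf]
    rw [Finset.prod_mul_distrib]
    refine mul_le_mul_left ?_ _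
    rw [← htsum, rpow_finset_sum _ _ _ ht0]
    refine Finset.prod_le_prod' fun j _ => ENNReal.rpow_le_rpow (ker_anti ?_) (ht0 j)
    have hco : ∀ k, |x k - y k| ≤ ‖x - y‖ := fun k => by
      simpa using PiLp.norm_apply_le (x - y) k
    rw [abs_of_nonneg (le_max_of_le_left (abs_nonneg _)), abs_of_nonneg (norm_nonneg _)]
    exact max_le (hco j) (hco i)
  set G : Euc (n + 1) × Euc (n + 1) → ENNReal := fun p =>
    ker ‖p.1 - p.2‖ ^ s * Nf p.1 * Nf p.2 with hG
  have hGm : Measurable G :=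
    (((measurable_ker.comp (by fun_prop)).pow_const s).mul (hNfm.comp measurable_fst)).mul
      (hNfm.comp measurable_snd)
  have hGint : ∫⁻ p, G p ≤ ENNReal.ofReal (K ^ (n + 1)) * ENNReal.ofReal (KM ^ (n + 1)) := by
    rw [Measure.volume_eq_prod, lintegral_prod_symm' _ hGm]
    calc _ ≤ ∫⁻ y, ENNReal.ofReal (K ^ (n + 1)) * Nf y := by
          refine lintegral_mono fun y => ?_
          simp only [hG]
          have hm : Measurable fun x : Euc (n + 1) => ker ‖x - y‖ ^ s * Nf x :=
            ((measurable_ker.comp (by fun_prop)).pow_const s).mul hNfm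
          rw [lintegral_mul_const _ hm]
          exact mul_le_mul_left (hpot y) _
      _ ≤ _ := by
          rw [lintegral_const_mul _ hNfm]
          exact mul_le_mul_right hmass _
  refine (le_abs_self _).trans ?_
  rw [← Real.norm_eq_abs]
  refine (norm_integral_le_lintegral_norm _).trans ?_
  refine ENNReal.toReal_le_of_le_ofReal (by positivity) ?_
  calc _ ≤ ∫⁻ p, ENNReal.ofReal BB * ENNReal.ofReal BB * G p := by
        refine lintegral_mono fun p => ?_
        have h1 := hmu p.1
        have h2 := hmu p.2
        have h3 : 0 ≤ ‖p.1 - p.2‖ ^ (-s) := by positivity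
        simp only [hG]
        rw [Real.norm_of_nonneg (mul_nonneg (mul_nonneg h3 h1.1) h2.1),
          ENNReal.ofReal_mul (mul_nonneg h3 h1.1), ENNReal.ofReal_mul h3]
        calc _ ≤ ker ‖p.1 - p.2‖ ^ s * (ENNReal.ofReal BB * Nf p.1) * (ENNReal.ofReal BB * Nf p.2) := by
              refine mul_le_mul' (mul_le_mul' (ofReal_norm_le_ker _ _ (norm_nonneg _) hs) h1.2) h2.2
          _ = _ := by ring
    _ = ENNReal.ofReal BB * ENNReal.ofReal BB * ∫⁻ p, G p := lintegral_const_mul _ hGm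
    _ ≤ ENNReal.ofReal BB * ENNReal.ofReal BB *
        (ENNReal.ofReal (K ^ (n + 1)) * ENNReal.ofReal (KM ^ (n + 1))) := mul_le_mul_right hGint _
    _ = ENNReal.ofReal (BB * BB * K ^ (n + 1) * KM ^ (n + 1)) := by
        rw [← ENNReal.ofReal_mul hBB0, ← ENNReal.ofReal_mul (by positivity),
          ← ENNReal.ofReal_mul (by positivity)]
        congr 1; ring
    _ ≤ _ := ENNReal.ofReal_le_ofReal (by linarith)
end
end

section
/- Let d ≥ 2, let s > 0, and let α₁, …, α_d > 0 satisfy Σ_{j=1}^d α_j = d and α_j ≤ d/s for every j. Fix C > 0 and an integer i with 1 ≤ i ≤ d. Then for every ε > 0 there exists C_ε > 0 such that for all q ≥ 1, q^{−2d} · q^{α_{i+1} + ⋯ + α_d} · Σ Π_{j=1}^{i} (|a_j − a'_j| / q^{α_j})^{−s/i} ≤ C_ε q^{ε}, where the sum is over all a₁, …, a_i, a'₁, …, a'_i ∈ ℤ with a_j ≠ a'_j, |a_j| ≤ C q^{α_j} and |a'_j| ≤ C q^{α_j} for each 1 ≤ j ≤ i. -/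
noncomputable section

open Classical in
/-- The one-coordinate summand, extended by zero. -/
def coordTerm (C t Q : ℝ) (x : ℤ × ℤ) : ℝ :=
  if x.1 ≠ x.2 ∧ |(x.1 : ℝ)| ≤ C * Q ∧ |(x.2 : ℝ)| ≤ C * Q then
    (|(x.1 : ℝ) - x.2| / Q) ^ (-t) else 0

/-- Box of integers. -/
def coordBox (C Q : ℝ) : Finset ℤ := Finset.Icc (-⌊C * Q⌋) ⌊C * Q⌋

theorem mem_coordBox {C Q : ℝ} {a : ℤ} (h : |(a : ℝ)| ≤ C * Q) : a ∈ coordBox C Q := by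
  rw [abs_le] at h
  rw [coordBox, Finset.mem_Icc]
  constructor
  · rw [neg_le, Int.le_floor]
    push_cast
    linarith
  · rw [Int.le_floor]
    exact h.2

theorem coordTerm_nonneg (C t Q : ℝ) (hQ : 1 ≤ Q) (x : ℤ × ℤ) : 0 ≤ coordTerm C t Q x := by
  unfold coordTerm
  split_ifs
  · positivity
  · exact le_rfl

theorem coordTerm_le (C t δ Q : ℝ) (hδ : 0 < δ) (hQ : 1 ≤ Q) (hC : 0 < C) (x : ℤ × ℤ) :
    coordTerm C t Q x ≤ (2 * C) ^ (max 1 t + δ - t) * Q ^ (max 1 t + δ) *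
      |((x.1 - x.2 : ℤ) : ℝ)| ^ (-(1 + δ)) := by
  have hQ0 : 0 < Q := by linarith
  unfold coordTerm
  split_ifs with h
  · obtain ⟨hne, h1, h2⟩ := h
    set n : ℝ := |((x.1 - x.2 : ℤ) : ℝ)| with hn
    have hn' : |(x.1 : ℝ) - x.2| = n := by rw [hn]; push_cast; rfl
    have hn1 : 1 ≤ n := by
      rw [hn, ← Int.cast_abs]
      exact_mod_cast Int.one_le_abs (sub_ne_zero.mpr hne)
    have hn0 : 0 < n := by linarith
    have hn2 : n ≤ 2 * C * Q := by
      rw [← hn']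
      have := abs_sub (x.1 : ℝ) x.2
      linarith
    rw [hn']
    have hT : t ≤ max 1 t := le_max_right _ _
    have hT1 : 1 ≤ max 1 t := le_max_left _ _
    have e1 : (n / Q) ^ (-t) = n ^ (max 1 t + δ - t) * n ^ (-(max 1 t + δ)) * Q ^ t := by
      rw [Real.div_rpow hn0.le hQ0.le, ← Real.rpow_add hn0, Real.rpow_neg hQ0.le, div_inv_eq_mul]
      congr 2
      ring
    have e2 : n ^ (max 1 t + δ - t) ≤ (2 * C * Q) ^ (max 1 t + δ - t) :=
      Real.rpow_le_rpow hn0.le hn2 (by linarith)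
    have e3 : n ^ (-(max 1 t + δ)) ≤ n ^ (-(1 + δ)) :=
      Real.rpow_le_rpow_of_exponent_le hn1 (by linarith)
    rw [e1]
    calc n ^ (max 1 t + δ - t) * n ^ (-(max 1 t + δ)) * Q ^ t
        ≤ (2 * C * Q) ^ (max 1 t + δ - t) * n ^ (-(1 + δ)) * Q ^ t := by gcongr
      _ = (2 * C) ^ (max 1 t + δ - t) * (Q ^ (max 1 t + δ - t) * Q ^ t) * n ^ (-(1 + δ)) := by
          rw [Real.mul_rpow (by positivity) hQ0.le]; ring
      _ = _ := by
          rw [← Real.rpow_add hQ0]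
          congr 3
          ring
  · positivity

theorem coord_sum (C t δ : ℝ) (hC : 0 < C) (hδ : 0 < δ) : ∃ K > (0 : ℝ), ∀ Q : ℝ, 1 ≤ Q →
    ∑ x ∈ coordBox C Q ×ˢ coordBox C Q, coordTerm C t Q x ≤ K * Q ^ (1 + max 1 t + δ) := by
  have hsum : Summable (fun n : ℤ => |(n : ℝ)| ^ (-(1 + δ))) :=
    Real.summable_abs_int_rpow (by linarith)
  set Z : ℝ := ∑' n : ℤ, |(n : ℝ)| ^ (-(1 + δ)) with hZ
  have hZ0 : 0 ≤ Z := tsum_nonneg fun n => by positivity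
  refine ⟨(2 * C + 1) * ((2 * C) ^ (max 1 t + δ - t) * (Z + 1)), by positivity, fun Q hQ => ?_⟩
  have hQ0 : 0 < Q := by linarith
  rw [Finset.sum_product]
  have hin : ∀ a ∈ coordBox C Q, ∑ b ∈ coordBox C Q, coordTerm C t Q (a, b) ≤
      (2 * C) ^ (max 1 t + δ - t) * Q ^ (max 1 t + δ) * (Z + 1) := by
    intro a _
    calc ∑ b ∈ coordBox C Q, coordTerm C t Q (a, b)
        ≤ ∑ b ∈ coordBox C Q, (2 * C) ^ (max 1 t + δ - t) * Q ^ (max 1 t + δ) *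
          |((a - b : ℤ) : ℝ)| ^ (-(1 + δ)) :=
          Finset.sum_le_sum fun b _ => coordTerm_le C t δ Q hδ hQ hC (a, b)
      _ = (2 * C) ^ (max 1 t + δ - t) * Q ^ (max 1 t + δ) *
          ∑ b ∈ coordBox C Q, |((a - b : ℤ) : ℝ)| ^ (-(1 + δ)) := by rw [Finset.mul_sum]
      _ ≤ _ := by
          gcongr
          have h1 : Summable (fun b : ℤ => |((a - b : ℤ) : ℝ)| ^ (-(1 + δ))) :=
            (Equiv.subLeft a).summable_iff.mpr hsum
          have h2 : ∑' b : ℤ, |((a - b : ℤ) : ℝ)| ^ (-(1 + δ)) = Z :=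
            (Equiv.subLeft a).tsum_eq (fun n : ℤ => |(n : ℝ)| ^ (-(1 + δ)))
          have h3 := h1.sum_le_tsum (coordBox C Q) (fun b _ => by positivity)
          linarith
  have hcard : ((coordBox C Q).card : ℝ) ≤ (2 * C + 1) * Q := by
    have h0 : 0 ≤ ⌊C * Q⌋ := Int.floor_nonneg.mpr (by positivity)
    have h1 : ((coordBox C Q).card : ℤ) = 2 * ⌊C * Q⌋ + 1 := by
      rw [coordBox, Int.card_Icc, Int.toNat_of_nonneg (by linarith)]
      ring
    have h2 : ((coordBox C Q).card : ℝ) = 2 * (⌊C * Q⌋ : ℝ) + 1 := by exact_mod_cast h1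
    have h3 := Int.floor_le (C * Q)
    rw [h2]
    nlinarith
  calc _ ≤ (coordBox C Q).card • ((2 * C) ^ (max 1 t + δ - t) * Q ^ (max 1 t + δ) * (Z + 1)) :=
        Finset.sum_le_card_nsmul _ _ _ hin
    _ ≤ ((2 * C + 1) * Q) * ((2 * C) ^ (max 1 t + δ - t) * Q ^ (max 1 t + δ) * (Z + 1)) := by
        rw [nsmul_eq_mul]
        gcongr
    _ = _ := by
        rw [add_assoc, Real.rpow_add hQ0 1, Real.rpow_one]
        ring

open Classical in
theorem tsum_factor (i : ℕ) (C t : ℝ) (Q : Fin i → ℝ) :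
    ∑' p : {p : (Fin i → ℤ) × (Fin i → ℤ) // ∀ j : Fin i,
            p.1 j ≠ p.2 j ∧ |(p.1 j : ℝ)| ≤ C * Q j ∧ |(p.2 j : ℝ)| ≤ C * Q j},
          ∏ j : Fin i, ((|p.val.1 j - p.val.2 j| : ℝ) / Q j) ^ (-t) =
    ∏ j : Fin i, ∑ x ∈ coordBox C (Q j) ×ˢ coordBox C (Q j), coordTerm C t (Q j) x := by
  have h1 := tsum_subtype {p : (Fin i → ℤ) × (Fin i → ℤ) | ∀ j : Fin i,
            p.1 j ≠ p.2 j ∧ |(p.1 j : ℝ)| ≤ C * Q j ∧ |(p.2 j : ℝ)| ≤ C * Q j}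
    (fun p => ∏ j : Fin i, ((|p.1 j - p.2 j| : ℝ) / Q j) ^ (-t))
  refine h1.trans ?_
  rw [Finset.prod_univ_sum, ← (Equiv.arrowProdEquivProdArrow (Fin i) (fun _ => ℤ) (fun _ => ℤ)).tsum_eq]
  rw [← tsum_eq_sum (L := SummationFilter.unconditional _)
    (f := fun h : Fin i → ℤ × ℤ => ∏ j, coordTerm C t (Q j) (h j))]
  · refine tsum_congr fun h => ?_
    rw [Set.indicator_apply]
    split_ifs with hh
    · refine Finset.prod_congr rfl fun j _ => ?_
      have := hh j
      exact (if_pos this).symm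
    · simp only [Set.mem_ofPred_eq, not_forall] at hh
      obtain ⟨j, hj⟩ := hh
      exact (Finset.prod_eq_zero (Finset.mem_univ j) (if_neg hj)).symm
  · intro h hh
    simp only [Fintype.mem_piFinset, not_forall] at hh
    obtain ⟨j, hj⟩ := hh
    refine Finset.prod_eq_zero (Finset.mem_univ j) (if_neg fun hc => hj ?_)
    exact Finset.mem_product.mpr ⟨mem_coordBox hc.2.1, mem_coordBox hc.2.2⟩

/-- Key multi-coordinate discrete sum bound in the proof of the non-isotropic energy
lemma: with `i` the Hamming distance between the lattice points (differing coordinates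
relabelled first),
`q^{−2d} q^{α_{i+1}+⋯+α_d} Σ Π_{j=1}^{i} (|a_j − a'_j|/q^{α_j})^{−s/i} ≲_ε q^ε`. -/
theorem multi_coordinate_sum_bound
    (d : ℕ) (hd : 2 ≤ d) (s : ℝ) (hs : 0 < s) (α : Fin d → ℝ)
    (hα : ∀ j, 0 < α j) (hsumα : ∑ j, α j = (d : ℝ)) (hαle : ∀ j, α j ≤ (d : ℝ) / s)
    (C : ℝ) (hC : 0 < C) (i : ℕ) (hi1 : 1 ≤ i) (hid : i ≤ d) :
    ∀ ε > (0 : ℝ), ∃ Cε > (0 : ℝ), ∀ q : ℝ, 1 ≤ q →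
      q ^ (-(2 * (d : ℝ))) *
        q ^ (∑ j ∈ Finset.univ.filter (fun j : Fin d => i ≤ j.val), α j) *
        ∑' p : {p : (Fin i → ℤ) × (Fin i → ℤ) // ∀ j : Fin i,
            p.1 j ≠ p.2 j ∧ |(p.1 j : ℝ)| ≤ C * q ^ (α (Fin.castLE hid j)) ∧
              |(p.2 j : ℝ)| ≤ C * q ^ (α (Fin.castLE hid j))},
          ∏ j : Fin i,
            ((|p.val.1 j - p.val.2 j| : ℝ) / q ^ (α (Fin.castLE hid j))) ^ (-(s / i)) ≤
      Cε * q ^ ε := by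
  intro ε hε
  have hd0 : (0 : ℝ) < d := by exact_mod_cast (by omega : 0 < d)
  have hi0 : (0 : ℝ) < i := by exact_mod_cast (by omega : 0 < i)
  obtain ⟨K, hK, hKb⟩ := coord_sum C (s / i) (ε / d) hC (by positivity)
  refine ⟨K ^ i, by positivity, fun q hq => ?_⟩
  have hq0 : 0 < q := by linarith
  rw [tsum_factor i C (s / i) (fun j => q ^ (α (Fin.castLE hid j)))]
  set A : ℝ := ∑ j : Fin i, α (Fin.castLE hid j) with hA
  set B : ℝ := ∑ j ∈ Finset.univ.filter (fun j : Fin d => i ≤ j.val), α j with hB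
  have hAB : A + B = d := by
    rw [← hsumα, ← Finset.sum_filter_add_sum_filter_not Finset.univ (fun j : Fin d => j.val < i)]
    congr 1
    · rw [hA]
      refine Finset.sum_bij (fun j _ => Fin.castLE hid j) ?_ ?_ ?_ ?_
      · intro a _
        simp
      · intro a _ b _ hab
        exact Fin.castLE_injective hid hab
      · intro b hb
        simp only [Finset.mem_filter, Finset.mem_univ, true_and] at hb
        exact ⟨⟨b.val, hb⟩, Finset.mem_univ _, rfl⟩
      · intro a _
        rfl
    · simp only [hB, not_lt]
  have hB0 : 0 ≤ B := Finset.sum_nonneg fun j _ => (hα j).le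
  have hA0 : 0 ≤ A := Finset.sum_nonneg fun j _ => (hα _).le
  have hAd : A ≤ d := by linarith
  have hA2 : A * (s / i) ≤ d := by
    have : A ≤ i * (d / s) := by
      calc A ≤ ∑ j : Fin i, (d : ℝ) / s := Finset.sum_le_sum fun j _ => hαle _
        _ = _ := by simp
    calc A * (s / i) ≤ i * (d / s) * (s / i) := by gcongr
      _ = d := by field_simp
  have hmax : A * max 1 (s / i) ≤ d := by
    rcases max_choice 1 (s / (i : ℝ)) with h | h <;> rw [h]
    · linarith
    · exact hA2
  have hAε : A * (ε / d) ≤ ε := by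
    calc A * (ε / d) ≤ d * (ε / d) := by gcongr
      _ = ε := by field_simp
  have hprod : ∏ j : Fin i, ∑ x ∈ coordBox C (q ^ (α (Fin.castLE hid j))) ×ˢ
      coordBox C (q ^ (α (Fin.castLE hid j))),
        coordTerm C (s / i) (q ^ (α (Fin.castLE hid j))) x ≤
      K ^ i * q ^ (A * (1 + max 1 (s / i) + ε / d)) := by
    calc _ ≤ ∏ j : Fin i, K * (q ^ (α (Fin.castLE hid j))) ^ (1 + max 1 (s / i) + ε / d) := by
          refine Finset.prod_le_prod (fun j _ => Finset.sum_nonneg fun x _ => ?_) fun j _ => ?_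
          · exact coordTerm_nonneg _ _ _ (Real.one_le_rpow hq (hα _).le) _
          · exact hKb _ (Real.one_le_rpow hq (hα _).le)
      _ = _ := by
          rw [Finset.prod_mul_distrib, Finset.prod_const, Finset.card_univ, Fintype.card_fin]
          congr 1
          rw [hA, Finset.sum_mul, Real.rpow_sum_of_pos hq0]
          exact Finset.prod_congr rfl fun j _ => (Real.rpow_mul hq0.le _ _).symm
  calc _ ≤ q ^ (-(2 * (d : ℝ))) * q ^ B * (K ^ i * q ^ (A * (1 + max 1 (s / i) + ε / d))) := by
        gcongr
    _ = K ^ i * q ^ (-(2 * (d : ℝ)) + B + A * (1 + max 1 (s / i) + ε / d)) := by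
        rw [Real.rpow_add hq0, Real.rpow_add hq0]
        ring
    _ ≤ K ^ i * q ^ ε := by
        gcongr
        nlinarith
end
end

section
/- Let s satisfy 1 < s < 2, let α₁, α₂ > 0 with α₁ + α₂ = 2 and α₂ ≤ 2/s, and let C > 0. Then there exists C' > 0 such that for all q ≥ 1, q^{−4} q^{s α₂} · (#{a₁ ∈ ℤ : |a₁| ≤ C q^{α₁}}) · Σ_{a₂, a'₂ ∈ ℤ, a₂ ≠ a'₂, |a₂| ≤ C q^{α₂}, |a'₂| ≤ C q^{α₂}} |a₂ − a'₂|^{−s} ≤ C'. -/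
noncomputable section

lemma count_aux (x : ℝ) : {a : ℤ | |(a : ℝ)| ≤ x} = ↑(Finset.Icc (-⌊x⌋) ⌊x⌋) := by
  ext a
  simp only [Set.mem_ofPred_eq, Finset.coe_Icc, Set.mem_Icc, abs_le]
  rw [neg_le (a := ⌊x⌋), Int.le_floor, Int.le_floor]
  push_cast
  constructor <;> rintro ⟨h1, h2⟩ <;> constructor <;> linarith

lemma card_aux (x : ℝ) (hx : 0 ≤ x) : ((Finset.Icc (-⌊x⌋) ⌊x⌋).card : ℝ) ≤ 2 * x + 1 := by
  have h0 : 0 ≤ ⌊x⌋ := Int.floor_nonneg.2 hx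
  have h : ((Finset.Icc (-⌊x⌋) ⌊x⌋).card : ℤ) = 2 * ⌊x⌋ + 1 := by
    rw [Int.card_Icc, Int.toNat_of_nonneg] <;> omega
  have h' : ((Finset.Icc (-⌊x⌋) ⌊x⌋).card : ℝ) = 2 * (⌊x⌋ : ℝ) + 1 := by exact_mod_cast h
  rw [h']
  linarith [Int.floor_le x]

lemma sum_aux (s : ℝ) (hs1 : 1 < s) (x : ℝ) (hx : 0 ≤ x) :
    ∑' p : {p : ℤ × ℤ // p.1 ≠ p.2 ∧ |(p.1 : ℝ)| ≤ x ∧ |(p.2 : ℝ)| ≤ x},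
          ((|p.val.1 - p.val.2| : ℤ) : ℝ) ^ (-s)
      ≤ (2 * x + 1) * ∑' n : ℤ, ((|n| : ℤ) : ℝ) ^ (-s) := by
  have hf : Summable (fun n : ℤ => ((|n| : ℤ) : ℝ) ^ (-s)) := by
    simpa using Real.summable_abs_int_rpow hs1
  have hnn : ∀ n : ℤ, 0 ≤ ((|n| : ℤ) : ℝ) ^ (-s) := fun n =>
    Real.rpow_nonneg (by exact_mod_cast abs_nonneg n) _
  set A := Finset.Icc (-⌊x⌋) ⌊x⌋ with hA
  have h1 : Summable (fun _ : A => (1 : ℝ)) := Summable.of_finite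
  have hg : Summable (fun z : A × ℤ => (1 : ℝ) * ((|z.2| : ℤ) : ℝ) ^ (-s)) :=
    h1.mul_of_nonneg hf (fun _ => zero_le_one) hnn
  have hprod := tsum_mul_tsum_of_summable_norm h1.norm hf.norm
  have hmem : ∀ a : ℤ, |(a : ℝ)| ≤ x → a ∈ A := fun a ha => by
    have : a ∈ {a : ℤ | |(a : ℝ)| ≤ x} := ha
    rw [count_aux] at this
    exact_mod_cast this
  let i : {p : ℤ × ℤ // p.1 ≠ p.2 ∧ |(p.1 : ℝ)| ≤ x ∧ |(p.2 : ℝ)| ≤ x} → A × ℤ :=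
    fun p => (⟨p.val.1, hmem _ p.2.2.1⟩, p.val.1 - p.val.2)
  have hi : Function.Injective i := by
    rintro ⟨⟨a, b⟩, hp⟩ ⟨⟨c, d⟩, hr⟩ h
    simp only [i, Prod.mk.injEq, Subtype.mk.injEq] at h ⊢
    omega
  have hle := tsum_comp_le_tsum_of_inj hg (fun z => mul_nonneg zero_le_one (hnn z.2)) hi
  rw [← hprod] at hle
  have hc : ∑' _ : A, (1 : ℝ) = (A.card : ℝ) := by simp
  rw [hc] at hle
  refine le_trans (le_of_eq ?_) (hle.trans ?_)
  · refine tsum_congr fun p => ?_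
    simp [i]
  · exact mul_le_mul_of_nonneg_right (card_aux x hx) (tsum_nonneg hnn)

/-- Case 1 (`a₁ = a'₁`, `a₂ ≠ a'₂`) of the two-dimensional non-isotropic energy
estimate:
`q^{−4} q^{sα₂} · #{a₁ : |a₁| ≤ C q^{α₁}} · Σ_{a₂ ≠ a'₂} |a₂ − a'₂|^{−s} ≤ C'`. -/
theorem two_dim_case_one
    (s : ℝ) (hs1 : 1 < s) (hs2 : s < 2) (α₁ α₂ : ℝ) (hα₁ : 0 < α₁) (hα₂ : 0 < α₂)
    (hsum : α₁ + α₂ = 2) (hle : α₂ ≤ 2 / s) (C : ℝ) (hC : 0 < C) :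
    ∃ C' > (0 : ℝ), ∀ q : ℝ, 1 ≤ q →
      q ^ (-(4 : ℝ)) * q ^ (s * α₂) *
        (Set.ncard {a : ℤ | |(a : ℝ)| ≤ C * q ^ α₁} : ℝ) *
        ∑' p : {p : ℤ × ℤ // p.1 ≠ p.2 ∧ |(p.1 : ℝ)| ≤ C * q ^ α₂ ∧
            |(p.2 : ℝ)| ≤ C * q ^ α₂},
          ((|p.val.1 - p.val.2| : ℤ) : ℝ) ^ (-s) ≤ C' := by
  have hZ : 0 ≤ ∑' n : ℤ, ((|n| : ℤ) : ℝ) ^ (-s) := tsum_nonneg fun n =>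
    Real.rpow_nonneg (by exact_mod_cast abs_nonneg n) _
  set Z := ∑' n : ℤ, ((|n| : ℤ) : ℝ) ^ (-s) with hZdef
  refine ⟨(2 * C + 1) * ((2 * C + 1) * Z) + 1, by positivity, fun q hq => ?_⟩
  have hq0 : 0 < q := by linarith
  have key : ∀ α : ℝ, 0 < α → 2 * (C * q ^ α) + 1 ≤ (2 * C + 1) * q ^ α := fun α hα => by
    linarith [Real.one_le_rpow hq hα.le]
  have hcard : (Set.ncard {a : ℤ | |(a : ℝ)| ≤ C * q ^ α₁} : ℝ) ≤ (2 * C + 1) * q ^ α₁ := by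
    rw [count_aux, Set.ncard_coe_finset]
    exact (card_aux _ (by positivity)).trans (key _ hα₁)
  have hS := (sum_aux s hs1 (C * q ^ α₂) (by positivity)).trans
    (mul_le_mul_of_nonneg_right (key _ hα₂) hZ)
  have hsα : s * α₂ ≤ 2 := by
    rw [le_div_iff₀ (by linarith)] at hle
    linarith
  have hpow : q ^ (-(4 : ℝ)) * q ^ (s * α₂) * q ^ α₁ * q ^ α₂ ≤ 1 := by
    rw [← Real.rpow_add hq0, ← Real.rpow_add hq0, ← Real.rpow_add hq0]
    exact Real.rpow_le_one_of_one_le_of_nonpos hq (by linarith)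
  have hS0 : 0 ≤ (2 * C + 1) * q ^ α₂ * Z := by positivity
  calc _ ≤ q ^ (-(4 : ℝ)) * q ^ (s * α₂) * ((2 * C + 1) * q ^ α₁) *
        ((2 * C + 1) * q ^ α₂ * Z) := by
        refine (mul_le_mul_of_nonneg_left hS (by positivity)).trans ?_
        gcongr
    _ = (q ^ (-(4 : ℝ)) * q ^ (s * α₂) * q ^ α₁ * q ^ α₂) *
        ((2 * C + 1) * ((2 * C + 1) * Z)) := by ring
    _ ≤ 1 * ((2 * C + 1) * ((2 * C + 1) * Z)) := by gcongr
    _ ≤ _ := by linarith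
end
end
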